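/- arXiv:2303.00305 — 2 statements merged into one kernel-verified Lean document; each statement's English description precedes it below -/
import Mathlib

section
/- Let F be the free group on generators a_1,…,a_r with r ≥ 2, and let K be the subgroup of F generated by F_4 together with all elements a_i², [a_i,a_j]², [[a_i,a_j],a_k]², and [[a_i,a_j],a_i] for i,j,k ∈ {1,…,r}. Then the quotient F'K/K is elementary abelian of order 2^{r(r-1)(2r-1)/6}, and the cosets cK for c in the set {[a_i,a_j] : 1 ≤ j < i ≤ r} ∪ {[[a_i,a_j],a_k] : 1 ≤ j < i ≤ r, j < k ≤ r, k ≠ i} form a basis of F'K/K as a vector space over the field with 2 elements. -/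
/-- The commutator `[g,h] = g⁻¹h⁻¹gh` (paper convention). -/
def gcomm {G : Type*} [Group G] (g h : G) : G := g⁻¹ * h⁻¹ * g * h

/-- The free group on `r` generators `a_1, …, a_r`. -/
abbrev FG (r : ℕ) := FreeGroup (Fin r)

/-- The generator `a_i` of the free group. -/
abbrev ag {r : ℕ} (i : Fin r) : FG r := FreeGroup.of i

/-- The subgroup `K` of `F`: generated by `F_4` together with all `a_i²`, `[a_i,a_j]²`,
`[[a_i,a_j],a_k]²` and `[[a_i,a_j],a_i]` (Mathlib's `lowerCentralSeries F 3` is `F_4`). -/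
def Ksub (r : ℕ) : Subgroup (FG r) :=
  Subgroup.closure
    (((⊤ : Subgroup (FG r)).lowerCentralSeries 3 : Set (FG r)) ∪
      ({w | ∃ i : Fin r, w = ag i ^ 2} ∪
       {w | ∃ i j : Fin r, w = gcomm (ag i) (ag j) ^ 2} ∪
       {w | ∃ i j k : Fin r, w = gcomm (gcomm (ag i) (ag j)) (ag k) ^ 2} ∪
       {w | ∃ i j : Fin r, w = gcomm (gcomm (ag i) (ag j)) (ag i)}))

/-- The proposed basis set: `{[a_i,a_j] : j < i} ∪ {[[a_i,a_j],a_k] : j < i, j < k, k ≠ i}`. -/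
def Bbasis (r : ℕ) : Set (FG r) :=
  {w | ∃ i j : Fin r, j < i ∧ w = gcomm (ag i) (ag j)} ∪
  {w | ∃ i j k : Fin r, j < i ∧ j < k ∧ k ≠ i ∧
    w = gcomm (gcomm (ag i) (ag j)) (ag k)}


namespace S8

/-- Index type of the basis: triples `(i,j,k)` with `j < i`, `j < k`;
`k = i` encodes the commutator `[a_i,a_j]`. -/
abbrev Idx (r : ℕ) := {t : Fin r × Fin r × Fin r // t.2.1 < t.1 ∧ t.2.1 < t.2.2}

/-- The basis elements, evaluated in a group. -/
def cc {r : ℕ} {G : Type*} [Group G] (x : Fin r → G) (t : Idx r) : G :=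
  if t.1.2.2 = t.1.1 then gcomm (x t.1.1) (x t.1.2.1)
  else gcomm (gcomm (x t.1.1) (x t.1.2.1)) (x t.1.2.2)

theorem Bbasis_eq (r : ℕ) : Bbasis r = Set.range (cc (ag : Fin r → FG r)) := by
  ext w
  constructor
  · rintro (⟨i, j, h, rfl⟩ | ⟨i, j, k, h1, h2, h3, rfl⟩)
    · exact ⟨⟨(i, j, i), h, h⟩, by simp [cc]⟩
    · exact ⟨⟨(i, j, k), h1, h2⟩, by simp [cc, h3]⟩
  · rintro ⟨⟨⟨i, j, k⟩, h1, h2⟩, rfl⟩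
    by_cases h : k = i
    · left; exact ⟨i, j, h1, by simp [cc, h]⟩
    · right; exact ⟨i, j, k, h1, h2, h, by simp [cc, h]⟩

theorem map_gcomm {G H : Type*} [Group G] [Group H] (f : G →* H) (a b : G) :
    f (gcomm a b) = gcomm (f a) (f b) := by simp [gcomm]

theorem map_cc {r : ℕ} {G H : Type*} [Group G] [Group H] (f : G →* H) (x : Fin r → G)
    (t : Idx r) : f (cc x t) = cc (fun i => f (x i)) t := by
  unfold cc; split_ifs <;> simp [map_gcomm]

section abstract_part

variable {r : ℕ} {G : Type*} [Group G] (x : Fin r → G)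

/-- The relations satisfied in `F/K`. -/
structure Rel : Prop where
  top : Subgroup.closure (Set.range x) = ⊤
  sq : ∀ i, x i * x i = 1
  csq : ∀ i j, gcomm (x i) (x j) * gcomm (x i) (x j) = 1
  tsq : ∀ i j k, gcomm (gcomm (x i) (x j)) (x k) * gcomm (gcomm (x i) (x j)) (x k) = 1
  rep : ∀ i j, gcomm (gcomm (x i) (x j)) (x i) = 1
  cen : ∀ i j k g, gcomm (gcomm (x i) (x j)) (x k) * g = g * gcomm (gcomm (x i) (x j)) (x k)

variable {x}

theorem Rel.inv (h : Rel x) (i) : (x i)⁻¹ = x i := inv_eq_of_mul_eq_one_left (h.sq i)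

theorem gcomm_inv' (a b : G) : (gcomm a b)⁻¹ = gcomm b a := by simp [gcomm, mul_assoc]

theorem Rel.symm (h : Rel x) (i j) : gcomm (x j) (x i) = gcomm (x i) (x j) := by
  rw [← gcomm_inv', inv_eq_of_mul_eq_one_left (h.csq i j)]

theorem Rel.rep' (h : Rel x) (i j) : gcomm (gcomm (x i) (x j)) (x j) = 1 := by
  rw [← h.symm, h.rep]

theorem hall_witt (a b c : G) :
    (b⁻¹ * gcomm (gcomm a b⁻¹) c * b) * (c⁻¹ * gcomm (gcomm b c⁻¹) a * c) *
      (a⁻¹ * gcomm (gcomm c a⁻¹) b * a) = 1 := by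
  simp only [gcomm]; group

theorem Rel.jacobi (h : Rel x) (i j k) :
    gcomm (gcomm (x i) (x j)) (x k) * gcomm (gcomm (x j) (x k)) (x i) *
      gcomm (gcomm (x k) (x i)) (x j) = 1 := by
  have := hall_witt (x i) (x j) (x k)
  rw [h.inv, h.inv, h.inv] at this
  rw [mul_assoc (x j) _ (x j), mul_assoc (x k) _ (x k), mul_assoc (x i) _ (x i),
    h.cen, h.cen, h.cen, ← mul_assoc (x j), ← mul_assoc (x k), ← mul_assoc (x i),
    h.sq, h.sq, h.sq] at this
  simpa using this

theorem gcomm_self (a : G) : gcomm a a = 1 := by simp [gcomm]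
theorem gcomm_one (a : G) : gcomm 1 a = 1 := by simp [gcomm]

theorem Rel.c_mem (h : Rel x) (i j) :
    gcomm (x i) (x j) ∈ Subgroup.closure (Set.range (cc x)) := by
  have key : ∀ i j, j < i → gcomm (x i) (x j) ∈ Subgroup.closure (Set.range (cc x)) :=
    fun i j hij => Subgroup.subset_closure ⟨⟨(i, j, i), hij, hij⟩, by simp [cc]⟩
  rcases lt_trichotomy i j with hl | rfl | hl
  · rw [← h.symm]; exact key _ _ hl
  · rw [gcomm_self]; exact one_mem _
  · exact key _ _ hl

theorem Rel.t_mem (h : Rel x) (i j k) :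
    gcomm (gcomm (x i) (x j)) (x k) ∈ Subgroup.closure (Set.range (cc x)) := by
  have k1 : ∀ i j k, j < i → j < k → 
      gcomm (gcomm (x i) (x j)) (x k) ∈ Subgroup.closure (Set.range (cc x)) := by
    intro i j k h1 h2
    by_cases hk : k = i
    · subst hk; rw [h.rep]; exact one_mem _
    · exact Subgroup.subset_closure ⟨⟨(i, j, k), h1, h2⟩, by simp [cc, hk]⟩
  have k2 : ∀ i j k, j < k → 
      gcomm (gcomm (x i) (x j)) (x k) ∈ Subgroup.closure (Set.range (cc x)) := by
    intro i j k h2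
    rcases lt_trichotomy i j with hl | rfl | hl
    · rw [← h.symm]; exact k1 _ _ _ hl (hl.trans h2)
    · rw [gcomm_self, gcomm_one]; exact one_mem _
    · exact k1 _ _ _ hl h2
  have k3 : ∀ i j k, i < k → 
      gcomm (gcomm (x i) (x j)) (x k) ∈ Subgroup.closure (Set.range (cc x)) := by
    intro i j k h2
    rw [← h.symm]; exact k2 _ _ _ h2
  rcases lt_trichotomy j k with hl | rfl | hl
  · exact k2 _ _ _ hl
  · rw [h.rep']; exact one_mem _
  rcases lt_trichotomy i k with hl' | rfl | hl'
  · exact k3 _ _ _ hl'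
  · rw [h.rep]; exact one_mem _
  have := h.jacobi i j k
  rw [mul_assoc] at this
  rw [eq_inv_of_mul_eq_one_left this]
  exact inv_mem (mul_mem (k2 _ _ _ hl') (k3 _ _ _ hl))

theorem Rel.conj_c (h : Rel x) (i j k) :
    x k * gcomm (x i) (x j) * (x k)⁻¹ =
      gcomm (x i) (x j) * gcomm (gcomm (x i) (x j)) (x k) := by
  rw [gcomm.eq_def (gcomm (x i) (x j)) (x k), h.inv]; group

theorem Rel.swap (h : Rel x) (i j k) :
    gcomm (x i) (x j) * x k =
      x k * gcomm (x i) (x j) * gcomm (gcomm (x i) (x j)) (x k) := by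
  rw [gcomm.eq_def (gcomm (x i) (x j)) (x k)]; group

theorem Rel.conj_t (h : Rel x) (i j k l) :
    x l * gcomm (gcomm (x i) (x j)) (x k) * (x l)⁻¹ = gcomm (gcomm (x i) (x j)) (x k) := by
  rw [← h.cen]; group

theorem Rel.c_comm (h : Rel x) (i j k l) :
    Commute (gcomm (x i) (x j)) (gcomm (x k) (x l)) := by
  have hz := h.cen i j k
  have hw := h.cen i j l
  have hz2 := h.tsq i j k
  have hw2 := h.tsq i j l
  have s1 := h.swap i j k
  have s2 := h.swap i j l
  rw [gcomm.eq_def (x k) (x l), h.inv, h.inv]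
  unfold Commute SemiconjBy
  generalize gcomm (gcomm (x i) (x j)) (x k) = z at *
  generalize gcomm (gcomm (x i) (x j)) (x l) = w at *
  generalize gcomm (x i) (x j) = c at *
  calc c * (x k * x l * x k * x l) = (c * x k) * x l * x k * x l := by simp only [mul_assoc]
    _ = x k * c * (z * (x l * x k * x l)) := by rw [s1]; simp only [mul_assoc]
    _ = x k * (c * x l) * x k * x l * z := by rw [hz]; simp only [mul_assoc]
    _ = x k * x l * c * (w * (x k * x l * z)) := by rw [s2]; simp only [mul_assoc]
    _ = x k * x l * (c * x k) * x l * z * w := by rw [hw]; simp only [mul_assoc]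
    _ = x k * x l * x k * c * (z * x l) * z * w := by rw [s1]; simp only [mul_assoc]
    _ = x k * x l * x k * (c * x l) * (z * z) * w := by rw [hz]; simp only [mul_assoc]
    _ = x k * x l * x k * x l * c * (w * w) := by rw [s2, hz2]; simp only [mul_assoc, one_mul]
    _ = x k * x l * x k * x l * c := by rw [hw2, mul_one]

theorem Rel.cc_comm (h : Rel x) (s t) : cc x s * cc x t = cc x t * cc x s := by
  unfold cc
  split_ifs
  · exact h.c_comm _ _ _ _
  · exact (h.cen _ _ _ _).symm
  · exact h.cen _ _ _ _
  · exact h.cen _ _ _ _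

theorem Rel.cc_sq (h : Rel x) (s) : cc x s * cc x s = 1 := by
  unfold cc
  split_ifs
  · exact h.csq _ _
  · exact h.tsq _ _ _

theorem Rel.normal (h : Rel x) : (Subgroup.closure (Set.range (cc x))).Normal := by
  have key : ∀ k, ∀ g ∈ Subgroup.closure (Set.range (cc x)),
      x k * g * (x k)⁻¹ ∈ Subgroup.closure (Set.range (cc x)) := by
    intro k g hg
    induction hg using Subgroup.closure_induction with
    | mem y hy =>
      obtain ⟨t, rfl⟩ := hy
      unfold cc
      split_ifs
      · rw [h.conj_c]; exact mul_mem (h.c_mem _ _) (h.t_mem _ _ _)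
      · rw [h.conj_t]; exact h.t_mem _ _ _
    | one => simp
    | mul a b _ _ ha hb =>
      have := mul_mem ha hb
      simpa [mul_assoc] using this
    | inv a _ ha =>
      have := inv_mem ha
      simpa [mul_assoc] using this
  rw [← Subgroup.normalizer_eq_top_iff, eq_top_iff, ← h.top, Subgroup.closure_le]
  rintro _ ⟨k, rfl⟩
  rw [SetLike.mem_coe, Subgroup.mem_normalizer_iff]
  intro g
  refine ⟨key k g, fun hg => ?_⟩
  have := key k _ hg
  have e : x k * (x k * g * (x k)⁻¹) * (x k)⁻¹ = (x k * x k) * g * (x k * x k)⁻¹ := by group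
  rw [e, h.sq] at this
  simpa using this

theorem Rel.commutator_le (h : Rel x) :
    commutator G ≤ Subgroup.closure (Set.range (cc x)) := by
  have := h.normal
  rw [← Subgroup.Normal.quotient_commutative_iff_commutator_le]
  set S := Subgroup.closure (Set.range (cc x))
  have hcl : Subgroup.closure (Set.range fun i => (x i : G ⧸ S)) = ⊤ := by
    have := congrArg (Subgroup.map (QuotientGroup.mk' S)) h.top
    rw [MonoidHom.map_closure, ← Set.range_comp,
      Subgroup.map_top_of_surjective _ (QuotientGroup.mk'_surjective S)] at this
    exact this
  have hc : ∀ a ∈ (Set.range fun i => (x i : G ⧸ S)), ∀ b ∈ (Set.range fun i => (x i : G ⧸ S)),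
      a * b = b * a := by
    rintro _ ⟨i, rfl⟩ _ ⟨j, rfl⟩
    have h1 : ((gcomm (x i) (x j) : G) : G ⧸ S) = 1 :=
      (QuotientGroup.eq_one_iff _).2 (h.c_mem i j)
    have h2 : x i * x j = x j * x i * gcomm (x i) (x j) := by rw [gcomm]; group
    change ((x i * x j : G) : G ⧸ S) = ((x j * x i : G) : G ⧸ S)
    rw [h2, QuotientGroup.mk_mul, h1, mul_one]
  have := Subgroup.isMulCommutative_closure hc
  rw [hcl] at this
  refine ⟨⟨fun a b => ?_⟩⟩
  have := this.is_comm.comm ⟨a, trivial⟩ ⟨b, trivial⟩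
  exact congrArg Subtype.val this

theorem Rel.sq_closure (h : Rel x) {g : G} (hg : g ∈ Subgroup.closure (Set.range (cc x))) :
    ∀ g' ∈ Subgroup.closure (Set.range (cc x)), g * g' = g' * g := by
  have hc : ∀ a ∈ Set.range (cc x), ∀ b ∈ Set.range (cc x), a * b = b * a := by
    rintro _ ⟨i, rfl⟩ _ ⟨j, rfl⟩; exact h.cc_comm _ _
  have := Subgroup.isMulCommutative_closure hc
  intro g' hg'
  exact congrArg Subtype.val (this.is_comm.comm ⟨g, hg⟩ ⟨g', hg'⟩)

/-- Normal form. -/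
theorem Rel.exists_prod (h : Rel x) {g : G} (hg : g ∈ Subgroup.closure (Set.range (cc x))) :
    ∃ n : Idx r → ℕ, g = ((Finset.univ : Finset (Idx r)).toList.map (fun t => cc x t ^ n t)).prod := by
  have hc : ∀ a ∈ Set.range (cc x), ∀ b ∈ Set.range (cc x), a * b = b * a := by
    rintro _ ⟨i, rfl⟩ _ ⟨j, rfl⟩; exact h.cc_comm _ _
  have := Subgroup.isMulCommutative_closure hc
  let S := Subgroup.closure (Set.range (cc x))
  let cS : Idx r → S := fun t => ⟨cc x t, Subgroup.subset_closure ⟨t, rfl⟩⟩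
  let _ : CommGroup S := { (inferInstance : Group S) with mul_comm := this.is_comm.comm }
  have e : ∀ n : Idx r → ℕ,
      ((Finset.univ : Finset (Idx r)).toList.map (fun t => cc x t ^ n t)).prod =
        ((∏ t, cS t ^ n t : S) : G) := by
    intro n
    rw [← Finset.prod_map_toList, ← Subgroup.coe_subtype, map_list_prod, List.map_map]
    rfl
  have sq : ∀ t, cS t * cS t = 1 := fun t => Subtype.ext (h.cc_sq t)
  have main : ∀ g : G, ∀ hg : g ∈ S, ∃ n : Idx r → ℕ, (⟨g, hg⟩ : S) = ∏ t, cS t ^ n t := by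
    intro g hg
    induction hg using Subgroup.closure_induction with
    | mem y hy =>
      obtain ⟨t, rfl⟩ := hy
      refine ⟨Pi.single t 1, ?_⟩
      rw [Finset.prod_eq_single t]
      · simp [cS]
      · intro b _ hb; simp [hb]
      · simp
    | one => exact ⟨0, by simp⟩
    | mul a b ha hb iha ihb =>
      obtain ⟨n, hn⟩ := iha
      obtain ⟨m, hm⟩ := ihb
      refine ⟨n + m, ?_⟩
      simp only [Pi.add_apply, pow_add, Finset.prod_mul_distrib]
      rw [← hn, ← hm]; rfl
    | inv a ha iha =>
      obtain ⟨n, hn⟩ := iha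
      refine ⟨n, ?_⟩
      rw [← hn]
      have : (⟨a, ha⟩ : S) * ⟨a, ha⟩ = 1 := by
        rw [hn, ← Finset.prod_mul_distrib]
        refine Finset.prod_eq_one fun t _ => ?_
        rw [← mul_pow, sq, one_pow]
      exact inv_eq_of_mul_eq_one_left this
  obtain ⟨n, hn⟩ := main g hg
  exact ⟨n, by rw [e, ← hn]⟩

theorem Rel.mul_self (h : Rel x) {g : G} (hg : g ∈ Subgroup.closure (Set.range (cc x))) :
    g * g = 1 := by
  induction hg using Subgroup.closure_induction with
  | mem y hy => obtain ⟨t, rfl⟩ := hy; exact h.cc_sq t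
  | one => simp
  | mul a b ha hb iha ihb =>
    have := h.sq_closure ha b hb
    calc a * b * (a * b) = a * b * (b * a) := by rw [this]
      _ = a * (b * b) * a := by group
      _ = 1 := by rw [ihb, mul_one, iha]
  | inv a ha iha => rw [← mul_inv_rev, iha, inv_one]

end abstract_part

/-! ### Normality of `K` and the relations in `F/K` -/

section Kpart

open scoped commutatorElement

variable {r : ℕ}

theorem gcomm_eq (g h : FG r) : gcomm g h = ⁅g⁻¹, h⁻¹⁆ := by
  simp [gcomm, commutatorElement_def]

theorem gcomm_mem_lcs {n : ℕ} {g : FG r} (hg : g ∈ (⊤ : Subgroup (FG r)).lowerCentralSeries n)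
    (h : FG r) : gcomm g h ∈ (⊤ : Subgroup (FG r)).lowerCentralSeries (n + 1) := by
  rw [gcomm_eq, Subgroup.lowerCentralSeries_succ]
  exact Subgroup.commutator_mem_commutator (inv_mem hg) trivial

theorem c_mem_lcs (g h : FG r) : gcomm g h ∈ (⊤ : Subgroup (FG r)).lowerCentralSeries 1 :=
  gcomm_mem_lcs (n := 0) trivial h

theorem t_mem_lcs (g h k : FG r) :
    gcomm (gcomm g h) k ∈ (⊤ : Subgroup (FG r)).lowerCentralSeries 2 :=
  gcomm_mem_lcs (c_mem_lcs g h) k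

theorem lcs_le_K : (⊤ : Subgroup (FG r)).lowerCentralSeries 3 ≤ Ksub r :=
  fun _ h => Subgroup.subset_closure (Or.inl h)

theorem K_sq (i : Fin r) : ag i ^ 2 ∈ Ksub r :=
  Subgroup.subset_closure (Or.inr (Or.inl (Or.inl (Or.inl ⟨i, rfl⟩))))

theorem K_csq (i j : Fin r) : gcomm (ag i) (ag j) ^ 2 ∈ Ksub r :=
  Subgroup.subset_closure (Or.inr (Or.inl (Or.inl (Or.inr ⟨i, j, rfl⟩))))

theorem K_tsq (i j k : Fin r) : gcomm (gcomm (ag i) (ag j)) (ag k) ^ 2 ∈ Ksub r :=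
  Subgroup.subset_closure (Or.inr (Or.inl (Or.inr ⟨i, j, k, rfl⟩)))

theorem K_rep (i j : Fin r) : gcomm (gcomm (ag i) (ag j)) (ag i) ∈ Ksub r :=
  Subgroup.subset_closure (Or.inr (Or.inr ⟨i, j, rfl⟩))

theorem K_cen {g : FG r} (hg : g ∈ (⊤ : Subgroup (FG r)).lowerCentralSeries 2) (h : FG r) :
    gcomm g h ∈ Ksub r := lcs_le_K (gcomm_mem_lcs hg h)

theorem conj_eq (g k : FG r) : k⁻¹ * g * k = g * gcomm g k := by simp [gcomm, mul_assoc]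

theorem conj_K (k : Fin r) : ∀ g ∈ Ksub r, (ag k)⁻¹ * g * ag k ∈ Ksub r := by
  intro g hg
  have three : ∀ g ∈ Ksub r, g ∈ (⊤ : Subgroup (FG r)).lowerCentralSeries 2 →
      (ag k)⁻¹ * g * ag k ∈ Ksub r := by
    intro g h1 h2
    rw [conj_eq]; exact mul_mem h1 (K_cen h2 _)
  unfold Ksub at hg
  induction hg using Subgroup.closure_induction with
  | mem y hy =>
    rcases hy with hy | ((⟨i, rfl⟩ | ⟨i, j, rfl⟩) | ⟨i, j, l, rfl⟩) | ⟨i, j, rfl⟩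
    · exact three _ (lcs_le_K hy) (Subgroup.lowerCentralSeries_antitone _ (by norm_num) hy)
    · have e : (ag k)⁻¹ * ag i ^ 2 * ag k = ag i ^ 2 * gcomm (ag i) (ag k) ^ 2 *
          gcomm (gcomm (ag i) (ag k)) (ag i) *
          gcomm (gcomm (gcomm (ag i) (ag k)) (ag i)) (gcomm (ag i) (ag k)) := by
        simp only [gcomm, pow_two]; group
      rw [e]
      exact mul_mem (mul_mem (mul_mem (K_sq _) (K_csq _ _)) (K_rep _ _)) (K_cen (t_mem_lcs _ _ _) _)
    · have e : ∀ c : FG r, (ag k)⁻¹ * c ^ 2 * ag k = c ^ 2 * gcomm c (ag k) ^ 2 *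
          gcomm (gcomm c (ag k)) c *
          gcomm (gcomm (gcomm c (ag k)) c) (gcomm c (ag k)) := by
        intro c; simp only [gcomm, pow_two]; group
      rw [e]
      refine mul_mem (mul_mem (mul_mem (K_csq _ _) (K_tsq _ _ _)) (K_cen (t_mem_lcs _ _ _) _)) ?_
      exact K_cen (t_mem_lcs _ _ _) _
    · exact three _ (K_tsq _ _ _) (pow_mem (t_mem_lcs _ _ _) 2)
    · exact three _ (K_rep _ _) (t_mem_lcs _ _ _)
  | one => simp
  | mul a b _ _ ha hb =>
    have := mul_mem ha hb
    simpa [mul_assoc] using this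
  | inv a _ ha =>
    have := inv_mem ha
    simpa [mul_assoc] using this

instance K_normal : (Ksub r).Normal := by
  rw [← Subgroup.normalizer_eq_top_iff, eq_top_iff, ← FreeGroup.closure_range_of,
    Subgroup.closure_le]
  rintro _ ⟨k, rfl⟩
  rw [SetLike.mem_coe, Subgroup.mem_normalizer_iff]
  intro g
  constructor
  · intro hg
    have h1 := mul_mem (mul_mem (K_sq k) (conj_K k g hg)) (inv_mem (K_sq k))
    have e : ag k ^ 2 * ((ag k)⁻¹ * g * ag k) * (ag k ^ 2)⁻¹ =
      FreeGroup.of k * g * (FreeGroup.of k)⁻¹ := by group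
    rwa [e] at h1
  · intro hg
    have h1 := conj_K k _ hg
    have e : (ag k)⁻¹ * (FreeGroup.of k * g * (FreeGroup.of k)⁻¹) * ag k = g := by group
    rwa [e] at h1

/-- Images of the generators in `F/K`. -/
def xq (r : ℕ) (i : Fin r) : FG r ⧸ Ksub r := QuotientGroup.mk' (Ksub r) (ag i)

theorem mk_one {g : FG r} : QuotientGroup.mk' (Ksub r) g = 1 ↔ g ∈ Ksub r :=
  QuotientGroup.eq_one_iff g

theorem rel_xq : Rel (xq r) where
  top := by
    have := congrArg (Subgroup.map (QuotientGroup.mk' (Ksub r)))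
      (FreeGroup.closure_range_of (Fin r))
    rw [MonoidHom.map_closure, ← Set.range_comp,
      Subgroup.map_top_of_surjective _ (QuotientGroup.mk'_surjective _)] at this
    exact this
  sq i := by
    simp only [xq, ← map_mul]; rw [mk_one, ← pow_two]; exact K_sq i
  csq i j := by
    simp only [xq, ← map_gcomm, ← map_mul]; rw [mk_one, ← pow_two]; exact K_csq i j
  tsq i j k := by
    simp only [xq, ← map_gcomm, ← map_mul]; rw [mk_one, ← pow_two]; exact K_tsq i j k
  rep i j := by
    simp only [xq, ← map_gcomm]; rw [mk_one]; exact K_rep i j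
  cen i j k g := by
    obtain ⟨g, rfl⟩ := QuotientGroup.mk'_surjective _ g
    simp only [xq, ← map_gcomm]
    have h := mk_one.2 (K_cen (t_mem_lcs (ag i) (ag j) (ag k)) g)
    have e : ∀ d : FG r, d * g = g * d * gcomm d g := by intro d; simp [gcomm, mul_assoc]
    rw [← map_mul, e, map_mul, h, mul_one, map_mul]

theorem mk_cc (t : Idx r) : QuotientGroup.mk' (Ksub r) (cc ag t) = cc (xq r) t :=
  map_cc _ _ _

/-- `F'K` maps into the span of the basis. -/
theorem H_map {g : FG r} (hg : g ∈ commutator (FG r) ⊔ Ksub r) :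
    QuotientGroup.mk' (Ksub r) g ∈ Subgroup.closure (Set.range (cc (xq r))) := by
  have : commutator (FG r) ⊔ Ksub r ≤
      (Subgroup.closure (Set.range (cc (xq r)))).comap (QuotientGroup.mk' (Ksub r)) := by
    refine sup_le ?_ ?_
    · rw [← Subgroup.map_le_iff_le_comap]
      refine le_trans ?_ rel_xq.commutator_le
      rw [commutator_def, Subgroup.map_commutator, commutator_def]
      exact Subgroup.commutator_mono le_top le_top
    · intro k hk
      rw [Subgroup.mem_comap, mk_one.2 hk]; exact one_mem _
  exact this hg

theorem cc_mem_comm (t : Idx r) : cc (ag : Fin r → FG r) t ∈ commutator (FG r) := by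
  rw [← Subgroup.top_lowerCentralSeries_one]
  unfold cc
  split_ifs
  · exact c_mem_lcs _ _
  · exact Subgroup.lowerCentralSeries_antitone _ (by norm_num) (t_mem_lcs _ _ _)

theorem cc_mem_H (t : Idx r) : cc (ag : Fin r → FG r) t ∈ commutator (FG r) ⊔ Ksub r :=
  (le_sup_left : _ ≤ commutator (FG r) ⊔ Ksub r) (cc_mem_comm t)

theorem part_sq : ∀ g ∈ commutator (FG r) ⊔ Ksub r, g * g ∈ Ksub r := by
  intro g hg
  rw [← mk_one, map_mul]
  exact rel_xq.mul_self (H_map hg)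

theorem part_comm : ∀ g ∈ commutator (FG r) ⊔ Ksub r, ∀ h ∈ commutator (FG r) ⊔ Ksub r,
      gcomm g h ∈ Ksub r := by
  intro g hg h hh
  rw [← mk_one, map_gcomm]
  have := rel_xq.sq_closure (H_map hg) _ (H_map hh)
  rw [gcomm, mul_assoc _ _ (QuotientGroup.mk' (Ksub r) h), this]
  group

theorem part_span : commutator (FG r) ⊔ Ksub r =
    Subgroup.closure ((Ksub r : Set (FG r)) ∪ Bbasis r) := by
  apply le_antisymm
  · intro g hg
    have h1 := H_map hg
    have e : Set.range (cc (xq r)) = QuotientGroup.mk' (Ksub r) '' Bbasis r := by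
      rw [Bbasis_eq, ← Set.range_comp]; congr 1; funext t; exact (mk_cc t).symm
    rw [e, ← MonoidHom.map_closure] at h1
    obtain ⟨b, hb, hbg⟩ := h1
    have hk : b⁻¹ * g ∈ Ksub r := by rw [← mk_one, map_mul, map_inv, hbg]; simp
    have e2 : g = b * (b⁻¹ * g) := by group
    rw [e2]
    exact mul_mem (Subgroup.closure_mono Set.subset_union_right hb)
      (Subgroup.subset_closure (Or.inl hk))
  · rw [Subgroup.closure_le, Bbasis_eq]
    rintro g (hg | ⟨t, rfl⟩)
    · exact (le_sup_right : _ ≤ commutator (FG r) ⊔ Ksub r) hg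
    · exact cc_mem_H t

/-- Normal form modulo `K`. -/
theorem nf {g : FG r} (hg : g ∈ commutator (FG r) ⊔ Ksub r) :
    ∃ n : Idx r → ℕ,
      g⁻¹ * ((Finset.univ : Finset (Idx r)).toList.map (fun t => cc ag t ^ n t)).prod ∈ Ksub r := by
  obtain ⟨n, hn⟩ := rel_xq.exists_prod (H_map hg)
  refine ⟨n, ?_⟩
  rw [← mk_one, map_mul, map_inv, hn, map_list_prod, List.map_map]
  rw [inv_mul_eq_one]
  congr 2
  funext t
  simp only [Function.comp_apply, map_pow, mk_cc]

end Kpart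

/-! ### The unitriangular model -/

/-- Upper unitriangular `4 × 4` matrices over `ZMod 2`. -/
@[ext] structure U where
  a : ZMod 2
  b : ZMod 2
  c : ZMod 2
  d : ZMod 2
  e : ZMod 2
  f : ZMod 2

instance : Mul U := ⟨fun x y => ⟨x.a + y.a, x.b + y.b, x.c + y.c, x.d + x.a * y.b + y.d,
  x.e + x.b * y.c + y.e, x.f + x.a * y.e + x.d * y.c + y.f⟩⟩
instance : One U := ⟨⟨0, 0, 0, 0, 0, 0⟩⟩
instance : Inv U := ⟨fun x => ⟨-x.a, -x.b, -x.c, x.a * x.b - x.d, x.b * x.c - x.e,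
  -x.f + x.a * x.e + x.d * x.c - x.a * x.b * x.c⟩⟩

section simps
variable (x y : U)
@[simp] theorem mul_a : (x * y).a = x.a + y.a := rfl
@[simp] theorem mul_b : (x * y).b = x.b + y.b := rfl
@[simp] theorem mul_c : (x * y).c = x.c + y.c := rfl
@[simp] theorem mul_d : (x * y).d = x.d + x.a * y.b + y.d := rfl
@[simp] theorem mul_e : (x * y).e = x.e + x.b * y.c + y.e := rfl
@[simp] theorem mul_f : (x * y).f = x.f + x.a * y.e + x.d * y.c + y.f := rfl
@[simp] theorem one_a : (1 : U).a = 0 := rfl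
@[simp] theorem one_b : (1 : U).b = 0 := rfl
@[simp] theorem one_c : (1 : U).c = 0 := rfl
@[simp] theorem one_d : (1 : U).d = 0 := rfl
@[simp] theorem one_e : (1 : U).e = 0 := rfl
@[simp] theorem one_f : (1 : U).f = 0 := rfl
@[simp] theorem inv_a : (x⁻¹).a = -x.a := rfl
@[simp] theorem inv_b : (x⁻¹).b = -x.b := rfl
@[simp] theorem inv_c : (x⁻¹).c = -x.c := rfl
@[simp] theorem inv_d : (x⁻¹).d = x.a * x.b - x.d := rfl
@[simp] theorem inv_e : (x⁻¹).e = x.b * x.c - x.e := rfl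
@[simp] theorem inv_f : (x⁻¹).f = -x.f + x.a * x.e + x.d * x.c - x.a * x.b * x.c := rfl
end simps

instance : Group U where
  mul_assoc x y z := by ext <;> simp <;> ring
  one_mul x := by ext <;> simp
  mul_one x := by ext <;> simp
  inv_mul_cancel x := by ext <;> simp [-ZMod.neg_eq_self_mod_two] <;> ring

/-- Second term of the lower central series. -/
def U1 : Subgroup U where
  carrier := {x | x.a = 0 ∧ x.b = 0 ∧ x.c = 0}
  mul_mem' := by rintro x y ⟨h1, h2, h3⟩ ⟨h4, h5, h6⟩; simp [*]
  one_mem' := by simp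
  inv_mem' := by rintro x ⟨h1, h2, h3⟩; simp [*]

/-- Third term of the lower central series. -/
def U2 : Subgroup U where
  carrier := {x | x.a = 0 ∧ x.b = 0 ∧ x.c = 0 ∧ x.d = 0 ∧ x.e = 0}
  mul_mem' := by rintro x y ⟨h1, h2, h3, h3', h3''⟩ ⟨h4, h5, h6, h7, h8⟩; simp [*]
  one_mem' := by simp
  inv_mem' := by rintro x ⟨h1, h2, h3, h4, h5⟩; simp [*]

theorem mem_U1 (x : U) : x ∈ U1 ↔ x.a = 0 ∧ x.b = 0 ∧ x.c = 0 := Iff.rfl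
theorem mem_U2 (x : U) : x ∈ U2 ↔ x.a = 0 ∧ x.b = 0 ∧ x.c = 0 ∧ x.d = 0 ∧ x.e = 0 := Iff.rfl

theorem lcs1 : (⊤ : Subgroup U).lowerCentralSeries 1 ≤ U1 := by
  rw [Subgroup.lowerCentralSeries_succ, Subgroup.commutator_le]
  intro x _ y _
  rw [commutatorElement_def, mem_U1]
  simp [-ZMod.neg_eq_self_mod_two]

theorem lcs2 : (⊤ : Subgroup U).lowerCentralSeries 2 ≤ U2 := by
  rw [Subgroup.lowerCentralSeries_succ, Subgroup.commutator_le]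
  intro x hx y _
  obtain ⟨h1, h2, h3⟩ := lcs1 hx
  rw [commutatorElement_def, mem_U2]
  simp [*, -ZMod.neg_eq_self_mod_two]
  constructor <;> ring

theorem lcs3 : (⊤ : Subgroup U).lowerCentralSeries 3 ≤ ⊥ := by
  rw [Subgroup.lowerCentralSeries_succ, Subgroup.commutator_le]
  intro x hx y _
  obtain ⟨h1, h2, h3, h4, h5⟩ := lcs2 hx
  rw [commutatorElement_def, Subgroup.mem_bot]
  ext <;> simp [*, -ZMod.neg_eq_self_mod_two] <;> ring

section model

variable {r : ℕ} (α β γ : Fin r → ZMod 2)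

/-- Element of the model attached to a generator. -/
def gen (i : Fin r) : U := ⟨α i, β i, γ i, 0, 0, 0⟩

/-- The representation. -/
def rho : FG r →* U := FreeGroup.lift (gen α β γ)

@[simp] theorem rho_of (i) : rho α β γ (FreeGroup.of i) = gen α β γ i := by simp [rho]

theorem two_eq (u : ZMod 2) : u + u = 0 := CharTwo.add_self_eq_zero u

variable {α β γ}

theorem gcomm_gen (h1 : ∀ i, α i * β i = 0) (h2 : ∀ i, β i * γ i = 0) (h3 : ∀ i, α i * γ i = 0)
    (i j) : gcomm (gen α β γ i) (gen α β γ j) =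
      ⟨0, 0, 0, α i * β j + α j * β i, β i * γ j + β j * γ i, 0⟩ := by
  have a1 := h1 i
  have a2 := h1 j
  have a3 := h2 i
  have a4 := h2 j
  have a5 := h3 i
  have a6 := h3 j
  ext <;> simp only [gcomm, gen, mul_a, mul_b, mul_c, mul_d, mul_e, mul_f, inv_a, inv_b, inv_c,
    inv_d, inv_e, inv_f] <;> generalize α i = p at * <;> generalize α j = p' at * <;>
    generalize β i = q at * <;> generalize β j = q' at * <;>
    generalize γ i = s at * <;> generalize γ j = s' at * <;> clear h1 h2 h3 <;>
    revert p p' q q' s s' <;> decide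

theorem gcomm_gen3 (h1 : ∀ i, α i * β i = 0) (h2 : ∀ i, β i * γ i = 0) (h3 : ∀ i, α i * γ i = 0)
    (i j k) : gcomm (gcomm (gen α β γ i) (gen α β γ j)) (gen α β γ k) =
      ⟨0, 0, 0, 0, 0, (α i * β j + α j * β i) * γ k + α k * (β i * γ j + β j * γ i)⟩ := by
  rw [gcomm_gen h1 h2 h3]
  generalize α i * β j + α j * β i = u
  generalize β i * γ j + β j * γ i = v
  ext <;> simp only [gcomm, gen, mul_a, mul_b, mul_c, mul_d, mul_e, mul_f, inv_a, inv_b, inv_c,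
    inv_d, inv_e, inv_f] <;> generalize α k = p at * <;> 
    generalize β k = q at * <;> generalize γ k = s at * <;>  clear h1 h2 h3 <;>
    revert u v p q s <;> decide

theorem K_le_ker (h1 : ∀ i, α i * β i = 0) (h2 : ∀ i, β i * γ i = 0) (h3 : ∀ i, α i * γ i = 0) :
    Ksub r ≤ (rho α β γ).ker := by
  unfold Ksub
  rw [Subgroup.closure_le]
  rintro w (hy | ((⟨i, rfl⟩ | ⟨i, j, rfl⟩) | ⟨i, j, l, rfl⟩) | ⟨i, j, rfl⟩) <;>
    rw [SetLike.mem_coe, MonoidHom.mem_ker]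
  · have h := Subgroup.mem_map_of_mem (rho α β γ) hy
    rw [Subgroup.map_lowerCentralSeries] at h
    exact lcs3 (Subgroup.lowerCentralSeries_mono 3 le_top h)
  · have := h1 i
    have := h2 i
    ext <;> simp [pow_two, gen, two_eq, *]
  · rw [map_pow, map_gcomm, rho_of, rho_of, gcomm_gen h1 h2 h3]
    ext <;> simp [pow_two, two_eq]
  · rw [map_pow, map_gcomm, map_gcomm, rho_of, rho_of, rho_of, gcomm_gen3 h1 h2 h3]
    ext <;> simp [pow_two, two_eq]
  · rw [map_gcomm, map_gcomm, rho_of, rho_of, gcomm_gen3 h1 h2 h3]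
    have a1 := h1 i
    have a3 := h2 i
    have a5 := h3 i
    ext <;> simp
    linear_combination β j * a5 + α j * a3 + γ j * a1 + β j * a5

theorem H_le (h1 : ∀ i, α i * β i = 0) (h2 : ∀ i, β i * γ i = 0) (h3 : ∀ i, α i * γ i = 0) :
    commutator (FG r) ⊔ Ksub r ≤ U1.comap (rho α β γ) := by
  refine sup_le ?_ ?_
  · rw [← Subgroup.top_lowerCentralSeries_one, ← Subgroup.map_le_iff_le_comap,
      Subgroup.map_lowerCentralSeries]
    exact (Subgroup.lowerCentralSeries_mono 1 le_top).trans lcs1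
  · intro k hk
    rw [Subgroup.mem_comap, (K_le_ker h1 h2 h3 hk : rho α β γ k = 1)]
    exact one_mem _

end model

section coords

variable {r : ℕ}

/-- First detecting function. -/
def fa (t : Idx r) : Fin r → ZMod 2 := fun l => if l = t.1.2.1 then 1 else 0
/-- Second detecting function. -/
def fb (t : Idx r) : Fin r → ZMod 2 := fun l => if l = t.1.1 then 1 else 0
/-- Third detecting function. -/
def fc (t : Idx r) : Fin r → ZMod 2 :=
  fun l => if t.1.2.2 = t.1.1 then 0 else if l = t.1.2.2 then 1 else 0

theorem fab (t : Idx r) (l) : fa t l * fb t l = 0 := by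
  have := t.2.1.ne
  unfold fa fb; split_ifs <;> simp_all

theorem fbc (t : Idx r) (l) : fb t l * fc t l = 0 := by
  unfold fb fc; split_ifs <;> simp_all

theorem fac (t : Idx r) (l) : fa t l * fc t l = 0 := by
  have := t.2.2.ne
  unfold fa fc; split_ifs <;> simp_all

/-- The coordinate functions on `F'K`. -/
def phi (t : Idx r) (g : FG r) : ZMod 2 :=
  if t.1.2.2 = t.1.1 then (rho (fa t) (fb t) (fc t) g).d else (rho (fa t) (fb t) (fc t) g).f

theorem phi_mul (t : Idx r) {g h : FG r} (hg : g ∈ commutator (FG r) ⊔ Ksub r)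
    (hh : h ∈ commutator (FG r) ⊔ Ksub r) : phi t (g * h) = phi t g + phi t h := by
  obtain ⟨h1, h2, h3⟩ := H_le (fab t) (fbc t) (fac t) hg
  obtain ⟨h4, h5, h6⟩ := H_le (fab t) (fbc t) (fac t) hh
  unfold phi
  split_ifs <;> simp [map_mul, h1, h6]

theorem phi_one (t : Idx r) : phi t 1 = 0 := by
  unfold phi; split_ifs <;> simp

theorem phi_K (t : Idx r) {g : FG r} (hg : g ∈ Ksub r) : phi t g = 0 := by
  unfold phi
  rw [MonoidHom.mem_ker.1 (K_le_ker (fab t) (fbc t) (fac t) hg)]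
  split_ifs <;> simp

theorem phi_cc (t s : Idx r) : phi t (cc ag s) = if s = t then 1 else 0 := by
  unfold phi
  rw [map_cc]
  simp only [rho_of]
  unfold cc
  rw [gcomm_gen3 (fab t) (fbc t) (fac t), gcomm_gen (fab t) (fbc t) (fac t)]
  obtain ⟨⟨i, j, k⟩, h1, h2⟩ := t
  obtain ⟨⟨i', j', k'⟩, h1', h2'⟩ := s
  simp only [fa, fb, fc, Subtype.mk.injEq, Prod.mk.injEq]
  simp only at h1 h2 h1' h2'
  have e1 : ¬ (i' = j ∧ j' = i) := by rintro ⟨rfl, rfl⟩; exact lt_asymm h1 h1'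
  have e2 : ¬ (k' = j ∧ j' = k) := by rintro ⟨rfl, rfl⟩; exact lt_asymm h2 h2'
  have e3 : ¬ (k' = j ∧ j' = i) := by rintro ⟨rfl, rfl⟩; exact lt_asymm h1 h2'

  by_cases a1 : k = i <;> by_cases a2 : k' = i' <;> simp only [a1, a2, if_true, if_false]
  · subst a1 a2; split_ifs <;> simp_all
  · subst a1; split_ifs <;> simp_all
  · subst a2; rw [if_neg]; rintro ⟨h, -, h'⟩; exact a1 (h'.symm.trans h)
  · split_ifs <;> simp_all

/-- The coordinate map. -/
def Phi (r : ℕ) : ↥(commutator (FG r) ⊔ Ksub r) →* Multiplicative (Idx r → ZMod 2) where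
  toFun g := Multiplicative.ofAdd (fun t => phi t g)
  map_one' := by
    rw [← ofAdd_zero]; congr 1; funext t; exact phi_one t
  map_mul' g h := by
    rw [← ofAdd_add]; congr 1; funext t; exact phi_mul t g.2 h.2

theorem list_mem (l : List (FG r)) (h : ∀ w ∈ l, w ∈ Bbasis r) :
    l.prod ∈ commutator (FG r) ⊔ Ksub r := by
  apply list_prod_mem
  intro w hw
  have := h w hw
  rw [Bbasis_eq] at this
  obtain ⟨t, rfl⟩ := this
  exact cc_mem_H t

theorem phi_pow (t : Idx r) {g : FG r} (hg : g ∈ commutator (FG r) ⊔ Ksub r) (n : ℕ) :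
    phi t (g ^ n) = n * phi t g := by
  induction n with
  | zero => simp [phi_one]
  | succ n ih => rw [pow_succ, phi_mul t (pow_mem hg n) hg, ih]; push_cast; ring

theorem phi_list (t : Idx r) (l : List (FG r)) (h : ∀ w ∈ l, w ∈ commutator (FG r) ⊔ Ksub r) :
    phi t l.prod = (l.map (phi t)).sum := by
  induction l with
  | nil => simp [phi_one]
  | cons w l ih =>
    have h' : ∀ w ∈ l, w ∈ commutator (FG r) ⊔ Ksub r :=
      fun w hw => h w (List.mem_cons_of_mem _ hw)
    rw [List.prod_cons, phi_mul t (h w List.mem_cons_self) (list_prod_mem h'), ih h']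
    simp

theorem nf_mem (n : Idx r → ℕ) :
    ∀ w ∈ (Finset.univ : Finset (Idx r)).toList.map (fun t => cc ag t ^ n t),
      w ∈ commutator (FG r) ⊔ Ksub r := by
  intro w hw
  obtain ⟨t, _, rfl⟩ := List.mem_map.1 hw
  exact pow_mem (cc_mem_H t) _

theorem phi_nf (t : Idx r) (n : Idx r → ℕ) :
    phi t ((Finset.univ : Finset (Idx r)).toList.map (fun t => cc ag t ^ n t)).prod = n t := by
  rw [phi_list t _ (nf_mem n), List.map_map, Finset.sum_map_toList]
  simp only [Function.comp_apply, phi_pow t (cc_mem_H _), phi_cc]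
  simp

theorem Phi_surj : Function.Surjective (Phi r) := by
  intro v
  refine ⟨⟨_, list_prod_mem (nf_mem fun t => (v.toAdd t).val)⟩, ?_⟩
  change Multiplicative.ofAdd _ = v
  rw [← ofAdd_toAdd v]
  congr 1
  funext t
  rw [phi_nf]; simp

theorem ker_Phi : (Phi r).ker = (Ksub r).subgroupOf (commutator (FG r) ⊔ Ksub r) := by
  ext ⟨g, hg⟩
  rw [MonoidHom.mem_ker, Subgroup.mem_subgroupOf]
  constructor
  · intro h
    have hphi : ∀ t, phi t g = 0 := fun t => congrFun (congrArg Multiplicative.toAdd h) t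
    obtain ⟨n, hn⟩ := nf hg
    have hz : ∀ t, (n t : ZMod 2) = 0 := by
      intro t
      have h1 := phi_nf t n
      have h2 := phi_mul t hg ((le_sup_right : _ ≤ commutator (FG r) ⊔ Ksub r) hn)
      rw [mul_inv_cancel_left, h1, hphi, phi_K t hn] at h2
      simpa using h2
    have hk : ((Finset.univ : Finset (Idx r)).toList.map (fun t => cc ag t ^ n t)).prod ∈ Ksub r := by
      apply list_prod_mem
      intro w hw
      obtain ⟨t, _, rfl⟩ := List.mem_map.1 hw
      obtain ⟨m, hm⟩ := (ZMod.natCast_eq_zero_iff _ _).1 (hz t)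
      rw [hm, pow_mul]
      apply pow_mem
      rw [pow_two]
      exact part_sq _ (cc_mem_H t)
    have := mul_mem hn (inv_mem hk)
    rw [mul_inv_cancel_right] at this
    exact inv_mem_iff.1 this
  · intro h
    change Multiplicative.ofAdd _ = 1
    rw [← ofAdd_zero]
    congr 1
    funext t
    exact phi_K t h

theorem sum_sq (r : ℕ) : 6 * ∑ m ∈ Finset.range r, m * m = r * (r - 1) * (2 * r - 1) := by
  induction r with
  | zero => simp
  | succ n ih =>
    rw [Finset.sum_range_succ, mul_add, ih]
    cases n with
    | zero => simp
    | succ n =>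
      have e1 : n + 1 - 1 = n := by omega
      have e2 : 2 * (n + 1) - 1 = 2 * n + 1 := by omega
      have e3 : n + 1 + 1 - 1 = n + 1 := by omega
      have e4 : 2 * (n + 1 + 1) - 1 = 2 * n + 3 := by omega
      rw [e1, e2, e3, e4]; ring

theorem card_Idx (r : ℕ) : Fintype.card (Idx r) = r * (r - 1) * (2 * r - 1) / 6 := by
  have e : Idx r ≃ Σ j : Fin r, {i // j < i} × {k // j < k} :=
    { toFun := fun t => ⟨t.1.2.1, ⟨t.1.1, t.2.1⟩, ⟨t.1.2.2, t.2.2⟩⟩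
      invFun := fun s => ⟨(s.2.1.1, s.1, s.2.2.1), s.2.1.2, s.2.2.2⟩
      left_inv := fun _ => rfl
      right_inv := fun _ => rfl }
  rw [Fintype.card_congr e, Fintype.card_sigma]
  have h : ∀ j : Fin r, Fintype.card ({i // j < i} × {k // j < k}) =
      (r - 1 - j) * (r - 1 - j) := by
    intro j
    rw [Fintype.card_prod, Fintype.card_subtype]
    have : (Finset.univ.filter fun i => j < i) = Finset.Ioi j := by ext; simp
    rw [this, Fin.card_Ioi]
  simp only [h]
  rw [Fin.sum_univ_eq_sum_range (fun j => (r - 1 - j) * (r - 1 - j)) r,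
    Finset.sum_range_reflect (fun m => m * m) r, ← sum_sq]
  simp

theorem part_index : (Ksub r).relIndex (commutator (FG r) ⊔ Ksub r) =
    2 ^ (r * (r - 1) * (2 * r - 1) / 6) := by
  rw [Subgroup.relIndex, ← ker_Phi, Subgroup.index_ker,
    MonoidHom.range_eq_top_of_surjective _ Phi_surj, Subgroup.card_top, ← card_Idx]
  change Nat.card (Idx r → ZMod 2) = _
  rw [Nat.card_eq_fintype_card, Fintype.card_fun, ZMod.card]

theorem part_indep (l : List (FG r)) (hn : l.Nodup) (hl : ∀ w ∈ l, w ∈ Bbasis r)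
    (hK : l.prod ∈ Ksub r) : l = [] := by
  cases l with
  | nil => rfl
  | cons w l =>
    exfalso
    have hw := hl w List.mem_cons_self
    rw [Bbasis_eq] at hw
    obtain ⟨t, rfl⟩ := hw
    have hB : ∀ w ∈ cc ag t :: l, w ∈ commutator (FG r) ⊔ Ksub r := by
      intro w hw
      have := hl w hw
      rw [Bbasis_eq] at this
      obtain ⟨t, rfl⟩ := this
      exact cc_mem_H t
    have h1 := phi_list t _ hB
    rw [phi_K t hK, List.map_cons, List.sum_cons, phi_cc, if_pos rfl, List.sum_eq_zero] at h1
    · simp at h1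
    · intro y hy
      obtain ⟨w, hw, rfl⟩ := List.mem_map.1 hy
      have := hl w (List.mem_cons_of_mem _ hw)
      rw [Bbasis_eq] at this
      obtain ⟨s, rfl⟩ := this
      rw [phi_cc, if_neg]
      rintro rfl
      exact (List.nodup_cons.1 hn).1 hw

end coords

end S8

/-- `F'K/K` is elementary abelian of order `2^{r(r-1)(2r-1)/6}`, with basis the cosets `cK`
for `c ∈ {[a_i,a_j] : j < i} ∪ {[[a_i,a_j],a_k] : j < i, j < k, k ≠ i}`.  This is expressed
quotient-freely: `[F'K : K] = 2^{r(r-1)(2r-1)/6}`; squares and commutators of elements of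
`F'K` lie in `K` (so `F'K/K` is an elementary abelian 2-group, i.e. a vector space over
`GF(2)`); the given set together with `K` generates `F'K` (the cosets span); and no nonempty
product of distinct elements of the given set lies in `K` (the cosets are distinct and
linearly independent over `GF(2)`). -/
theorem statement8 (r : ℕ) (hr : 2 ≤ r) :
    (Ksub r).relIndex (commutator (FG r) ⊔ Ksub r) = 2 ^ (r * (r - 1) * (2 * r - 1) / 6) ∧
    (∀ g ∈ commutator (FG r) ⊔ Ksub r, g * g ∈ Ksub r) ∧
    (∀ g ∈ commutator (FG r) ⊔ Ksub r, ∀ h ∈ commutator (FG r) ⊔ Ksub r,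
      gcomm g h ∈ Ksub r) ∧
    commutator (FG r) ⊔ Ksub r = Subgroup.closure ((Ksub r : Set (FG r)) ∪ Bbasis r) ∧
    (∀ l : List (FG r), l.Nodup → (∀ w ∈ l, w ∈ Bbasis r) → l.prod ∈ Ksub r → l = []) := by
  exact ⟨S8.part_index, S8.part_sq, S8.part_comm, S8.part_span, S8.part_indep⟩
end

section
/- Let n ≥ 2, let F be the free group on a_1,…,a_{2n}, and let I be defined as above. Then the assignment x_i ↦ a_iI and y_i ↦ a_{n+i}I (for i = 1,…,n) defines a group isomorphism from H(n) to F/I. In particular |H(n)| = 2^{(n³+n²+4n)/2}. -/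
/-- The generator index set for `H(n)`: `Sum.inl i` is `x_i`, `Sum.inr j` is `y_j`. -/
abbrev HGen (n : ℕ) := Fin n ⊕ Fin n

/-- The word `x_i` in the free group. -/
def xw {n : ℕ} (i : Fin n) : FreeGroup (HGen n) := FreeGroup.of (Sum.inl i)

/-- The word `y_j` in the free group. -/
def yw {n : ℕ} (j : Fin n) : FreeGroup (HGen n) := FreeGroup.of (Sum.inr j)

/-- The word `z` in the free group, for a generator `z`. -/
def zw {n : ℕ} (z : HGen n) : FreeGroup (HGen n) := FreeGroup.of z

/-- The relators of the presentation of `H(n)`. -/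
def HRels (n : ℕ) : Set (FreeGroup (HGen n)) :=
  {w | ∃ z, w = zw z ^ 2} ∪
  {w | ∃ i j, w = gcomm (xw i) (xw j)} ∪
  {w | ∃ i j, w = gcomm (yw i) (yw j)} ∪
  {w | ∃ i j, w = gcomm (xw i) (yw j) ^ 2} ∪
  {w | ∃ i j k, w = gcomm (gcomm (yw j) (xw i)) (yw k)} ∪
  {w | ∃ i j z, w = gcomm (gcomm (xw i) (yw j)) (zw z) ^ 2} ∪
  {w | ∃ z₁ z₂ z₃ z₄, w = gcomm (gcomm (gcomm (zw z₁) (zw z₂)) (zw z₃)) (zw z₄)}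

/-- The group `H(n)` defined by the presentation. -/
abbrev Hn (n : ℕ) := PresentedGroup (HRels n)

/-- The image of the generator `x_i` in `H(n)`. -/
def xH {n : ℕ} (i : Fin n) : Hn n := PresentedGroup.of (Sum.inl i)

/-- The image of the generator `y_j` in `H(n)`. -/
def yH {n : ℕ} (j : Fin n) : Hn n := PresentedGroup.of (Sum.inr j)

/-- The subgroup `X = ⟨x_1, …, x_n⟩` of `H(n)`. -/
def XH (n : ℕ) : Subgroup (Hn n) := Subgroup.closure (Set.range (xH (n := n)))

/-- The subgroup `Y = ⟨y_1, …, y_n⟩` of `H(n)`. -/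
def YH (n : ℕ) : Subgroup (Hn n) := Subgroup.closure (Set.range (yH (n := n)))

/-- The free group `F` on the `2n` generators `a_1, …, a_{2n}`, with index set split as
`HGen n = Fin n ⊕ Fin n`: `Sum.inl i` indexes `A_0 = {a_1,…,a_n}` and `Sum.inr i` indexes
`B_0 = {a_{n+1},…,a_{2n}}`. -/
abbrev F2 (n : ℕ) := FreeGroup (HGen n)

/-- The subgroup `K` of `F`: generated by `F_4` together with all `a_i²`, `[a_i,a_j]²`,
`[[a_i,a_j],a_k]²` and `[[a_i,a_j],a_i]` for `i,j,k ∈ {1,…,2n}` (Mathlib's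
`lowerCentralSeries F 3` is `F_4`). -/
def K2 (n : ℕ) : Subgroup (F2 n) :=
  Subgroup.closure
    ((Subgroup.lowerCentralSeries (⊤ : Subgroup (F2 n)) 3 : Set (F2 n)) ∪
      ({w | ∃ z, w = zw z ^ 2} ∪
       {w | ∃ z z', w = gcomm (zw (n := n) z) (zw z') ^ 2} ∪
       {w | ∃ z z' z'', w = gcomm (gcomm (zw (n := n) z) (zw z')) (zw z'') ^ 2} ∪
       {w | ∃ z z', w = gcomm (gcomm (zw (n := n) z) (zw z')) (zw z)}))

/-- The subgroup `I` of `F`: generated by `K` together with all `[a,a']`, `[b,b']`,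
`[[a,a'],c]`, `[[b,b'],c]`, `[[b,a],b']` for `a,a' ∈ A_0`, `b,b' ∈ B_0`,
`c ∈ A_0 ∪ B_0`. -/
def I2 (n : ℕ) : Subgroup (F2 n) :=
  Subgroup.closure
    ((K2 n : Set (F2 n)) ∪
      ({w | ∃ i j : Fin n, w = gcomm (xw i) (xw j)} ∪
       {w | ∃ i j : Fin n, w = gcomm (yw i) (yw j)} ∪
       {w | ∃ (i j : Fin n) (z : HGen n), w = gcomm (gcomm (xw i) (xw j)) (zw z)} ∪
       {w | ∃ (i j : Fin n) (z : HGen n), w = gcomm (gcomm (yw i) (yw j)) (zw z)} ∪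
       {w | ∃ (i j : Fin n) (k : Fin n), w = gcomm (gcomm (yw i) (xw k)) (yw j)}))


namespace St12

theorem normal_of_gens {G : Type*} [Group G] (T S : Set G)
    (hT : Subgroup.closure T = ⊤)
    (h : ∀ z ∈ T, ∀ s ∈ S, gcomm s z ∈ Subgroup.closure S)
    (h2 : ∀ z ∈ T, z ^ 2 ∈ Subgroup.closure S) : (Subgroup.closure S).Normal := by
  have key : ∀ z ∈ T, ∀ s ∈ Subgroup.closure S, z⁻¹ * s * z ∈ Subgroup.closure S := by
    intro z hz s hs
    induction hs using Subgroup.closure_induction with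
    | mem s hs =>
      have := mul_mem (Subgroup.subset_closure hs) (h z hz s hs)
      have e : s * gcomm s z = z⁻¹ * s * z := by unfold gcomm; group
      rwa [e] at this
    | one => simp
    | mul a b _ _ ha hb =>
      have e : z⁻¹ * (a * b) * z = (z⁻¹ * a * z) * (z⁻¹ * b * z) := by group
      rw [e]; exact mul_mem ha hb
    | inv a _ ha =>
      have e : z⁻¹ * a⁻¹ * z = (z⁻¹ * a * z)⁻¹ := by group
      rw [e]; exact inv_mem ha
  have key2 : ∀ z ∈ T, ∀ s ∈ Subgroup.closure S, z * s * z⁻¹ ∈ Subgroup.closure S := by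
    intro z hz s hs
    have e : z * s * z⁻¹ = z ^ 2 * (z⁻¹ * s * z) * (z ^ 2)⁻¹ := by group
    rw [e]
    exact mul_mem (mul_mem (h2 z hz) (key z hz s hs)) (inv_mem (h2 z hz))
  constructor
  intro s hs g
  have hg : g ∈ Subgroup.closure T := by rw [hT]; trivial
  have : ∀ s ∈ Subgroup.closure S,
      g * s * g⁻¹ ∈ Subgroup.closure S ∧ g⁻¹ * s * g ∈ Subgroup.closure S := by
    induction hg using Subgroup.closure_induction with
    | mem z hz => exact fun s hs => ⟨key2 z hz s hs, key z hz s hs⟩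
    | one => intro s hs; simpa using hs
    | mul a b _ _ ha hb =>
      intro s hs
      have e1 : a * b * s * (a * b)⁻¹ = a * (b * s * b⁻¹) * a⁻¹ := by group
      have e2 : (a * b)⁻¹ * s * (a * b) = b⁻¹ * (a⁻¹ * s * a) * b := by group
      rw [e1, e2]
      exact ⟨(ha _ (hb s hs).1).1, (hb _ (ha s hs).2).2⟩
    | inv a _ ha => intro s hs; simpa using (ha s hs).symm
  exact (this s hs).1

theorem gcomm_sq {G : Type*} [Group G] (g h : G) :
    gcomm (g ^ 2) h = gcomm g h * gcomm (gcomm g h) g * gcomm g h := by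
  simp only [gcomm, pow_two]; group

theorem gcomm_eq_one {G : Type*} [Group G] {g h : G} : gcomm g h = 1 ↔ g * h = h * g := by
  have e : gcomm g h = (h * g)⁻¹ * (g * h) := by unfold gcomm; group
  rw [e, inv_mul_eq_one, eq_comm]

theorem gcomm_inv {G : Type*} [Group G] (g h : G) : (gcomm g h)⁻¹ = gcomm h g := by
  unfold gcomm; group

theorem map_gcomm {G G' : Type*} [Group G] [Group G'] (f : G →* G') (g h : G) :
    f (gcomm g h) = gcomm (f g) (f h) := by
  simp [gcomm]

theorem gcomm_mem {G : Type*} [Group G] {A B : Subgroup G} {g h : G} (hg : g ∈ A) (hh : h ∈ B) :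
    gcomm g h ∈ ⁅A, B⁆ := by
  have := Subgroup.commutator_mem_commutator (inv_mem hg) (inv_mem hh)
  simpa [commutatorElement_def, gcomm] using this

abbrev L3 (n : ℕ) : Subgroup (F2 n) := Subgroup.lowerCentralSeries (⊤ : Subgroup (F2 n)) 3

theorem gcomm_L3 {n : ℕ} (a b c d : F2 n) : gcomm (gcomm (gcomm a b) c) d ∈ L3 n :=
  gcomm_mem (gcomm_mem (gcomm_mem (by trivial) (by trivial)) (by trivial)) (by trivial)

instance (n : ℕ) : (L3 n).Normal := by unfold L3; infer_instance

theorem closure_zw (n : ℕ) : Subgroup.closure (Set.range (zw (n := n))) = ⊤ :=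
  FreeGroup.closure_range_of _

theorem L3_le_K2 (n : ℕ) : L3 n ≤ K2 n := fun _ h => Subgroup.subset_closure (Or.inl h)

theorem K2_normal (n : ℕ) : (K2 n).Normal := by
  refine normal_of_gens (Set.range (zw (n := n))) _ (closure_zw n) ?_ ?_
  · change ∀ z ∈ Set.range (zw (n := n)), ∀ s ∈ _, gcomm s z ∈ K2 n
    rintro _ ⟨z, rfl⟩ s (hs | (((⟨a, rfl⟩ | ⟨a, b, rfl⟩) | ⟨a, b, c, rfl⟩) | ⟨a, b, rfl⟩))
    · refine L3_le_K2 n ?_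
      have := Subgroup.Normal.conj_mem (H := L3 n) inferInstance s hs (zw z)⁻¹
      have h2 := mul_mem (inv_mem hs) this
      simpa [gcomm, mul_assoc] using h2
    · rw [gcomm_sq]
      set d := gcomm (zw a) (zw z) with hd
      have h1 : d ^ 2 ∈ K2 n := Subgroup.subset_closure
        (Or.inr (Or.inl (Or.inl (Or.inr ⟨a, z, rfl⟩))))
      have h2 : gcomm d (zw a) ∈ K2 n := Subgroup.subset_closure
        (Or.inr (Or.inr ⟨a, z, rfl⟩))
      have h3 : gcomm (gcomm d (zw a)) d ∈ K2 n := L3_le_K2 n (gcomm_L3 _ _ _ _)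
      have e : d * gcomm d (zw a) * d = d ^ 2 * (gcomm d (zw a)) * gcomm (gcomm d (zw a)) d := by
        simp only [gcomm, pow_two]; group
      rw [e]
      exact mul_mem (mul_mem h1 h2) h3
    · rw [gcomm_sq]
      set t := gcomm (gcomm (zw a) (zw b)) (zw z) with ht
      have h1 : t ^ 2 ∈ K2 n := Subgroup.subset_closure
        (Or.inr (Or.inl (Or.inr ⟨a, b, z, rfl⟩)))
      set d := gcomm (zw a) (zw b) with hd
      have h3 : gcomm t d ∈ L3 n := (gcomm_L3 _ _ _ _)
      have h4 : t⁻¹ * gcomm t d * t ∈ L3 n := by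
        simpa using Subgroup.Normal.conj_mem (H := L3 n) inferInstance _ h3 t⁻¹
      have e : t * gcomm t d * t = t ^ 2 * (t⁻¹ * gcomm t d * t) := by
        simp only [pow_two]; group
      rw [e]
      exact mul_mem h1 (L3_le_K2 n h4)
    · rw [gcomm_sq]
      refine L3_le_K2 n ?_
      refine mul_mem (mul_mem (gcomm_L3 _ _ _ _) ?_) (gcomm_L3 _ _ _ _)
      exact gcomm_L3 _ _ _ _
    · exact L3_le_K2 n (gcomm_L3 _ _ _ _)
  · rintro _ ⟨z, rfl⟩
    exact Subgroup.subset_closure (Or.inr (Or.inl (Or.inl (Or.inl ⟨z, rfl⟩))))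

theorem K2_le_I2 (n : ℕ) : K2 n ≤ I2 n := fun _ h => Subgroup.subset_closure (Or.inl h)

theorem I2_normal (n : ℕ) : (I2 n).Normal := by
  refine normal_of_gens (Set.range (zw (n := n))) _ (closure_zw n) ?_ ?_
  · change ∀ z ∈ Set.range (zw (n := n)), ∀ s ∈ _, gcomm s z ∈ I2 n
    rintro _ ⟨z, rfl⟩ s (hs | ((((⟨a, b, rfl⟩ | ⟨a, b, rfl⟩) | ⟨a, b, c, rfl⟩) | ⟨a, b, c, rfl⟩) |
      ⟨a, b, c, rfl⟩))
    · refine K2_le_I2 n ?_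
      have := Subgroup.Normal.conj_mem (K2_normal n) s hs (zw z)⁻¹
      have h2 := mul_mem (inv_mem hs) this
      simpa [gcomm, mul_assoc] using h2
    · exact Subgroup.subset_closure (Or.inr (Or.inl (Or.inl (Or.inr ⟨a, b, z, rfl⟩))))
    · exact Subgroup.subset_closure (Or.inr (Or.inl (Or.inr ⟨a, b, z, rfl⟩)))
    all_goals exact K2_le_I2 n (L3_le_K2 n (gcomm_L3 _ _ _ _))
  · rintro _ ⟨z, rfl⟩
    exact K2_le_I2 n (Subgroup.subset_closure (Or.inr (Or.inl (Or.inl (Or.inl ⟨z, rfl⟩)))))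

theorem HRels_sub (n : ℕ) : HRels n ⊆ I2 n := by
  rintro _ ((((((⟨z, rfl⟩ | ⟨i, j, rfl⟩) | ⟨i, j, rfl⟩) | ⟨i, j, rfl⟩) | ⟨i, j, k, rfl⟩) |
    ⟨i, j, z, rfl⟩) | ⟨a, b, c, d, rfl⟩)
  · exact K2_le_I2 n (Subgroup.subset_closure (Or.inr (Or.inl (Or.inl (Or.inl ⟨z, rfl⟩)))))
  · exact Subgroup.subset_closure (Or.inr (Or.inl (Or.inl (Or.inl (Or.inl ⟨i, j, rfl⟩)))))
  · exact Subgroup.subset_closure (Or.inr (Or.inl (Or.inl (Or.inl (Or.inr ⟨i, j, rfl⟩)))))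
  · exact K2_le_I2 n (Subgroup.subset_closure (Or.inr (Or.inl (Or.inl (Or.inr ⟨_, _, rfl⟩)))))
  · exact Subgroup.subset_closure (Or.inr (Or.inr ⟨j, k, i, rfl⟩))
  · exact K2_le_I2 n (Subgroup.subset_closure (Or.inr (Or.inl (Or.inr ⟨_, _, _, rfl⟩))))
  · exact K2_le_I2 n (L3_le_K2 n (gcomm_L3 _ _ _ _))

/-! Relations in `H(n)`. -/

abbrev q (n : ℕ) : F2 n →* Hn n := PresentedGroup.mk (HRels n)

def zH {n : ℕ} (z : HGen n) : Hn n := PresentedGroup.of z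

theorem q_zw {n : ℕ} (z : HGen n) : q n (zw z) = zH z := rfl
theorem q_xw {n : ℕ} (i : Fin n) : q n (xw i) = xH i := rfl
theorem q_yw {n : ℕ} (i : Fin n) : q n (yw i) = yH i := rfl

theorem q_rel {n : ℕ} {w : F2 n} (h : w ∈ HRels n) : q n w = 1 := PresentedGroup.one_of_mem h

theorem zH_sq {n : ℕ} (z : HGen n) : zH z ^ 2 = 1 := by
  have := q_rel (n := n) (w := zw z ^ 2)
    (Or.inl (Or.inl (Or.inl (Or.inl (Or.inl (Or.inl ⟨z, rfl⟩))))))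
  simpa only [map_pow, q_zw] using this

theorem xx {n : ℕ} (i j : Fin n) : gcomm (xH i) (xH j) = 1 := by
  have := q_rel (n := n) (w := gcomm (xw i) (xw j))
    (Or.inl (Or.inl (Or.inl (Or.inl (Or.inl (Or.inr ⟨i, j, rfl⟩))))))
  simpa only [map_gcomm, q_xw] using this

theorem yy {n : ℕ} (i j : Fin n) : gcomm (yH i) (yH j) = 1 := by
  have := q_rel (n := n) (w := gcomm (yw i) (yw j))
    (Or.inl (Or.inl (Or.inl (Or.inl (Or.inr ⟨i, j, rfl⟩)))))
  simpa only [map_gcomm, q_yw] using this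

theorem xy_sq {n : ℕ} (i j : Fin n) : gcomm (xH i) (yH j) ^ 2 = 1 := by
  have := q_rel (n := n) (w := gcomm (xw i) (yw j) ^ 2)
    (Or.inl (Or.inl (Or.inl (Or.inr ⟨i, j, rfl⟩))))
  simpa only [map_gcomm, map_pow, q_xw, q_yw] using this

theorem yxy {n : ℕ} (i j k : Fin n) : gcomm (gcomm (yH j) (xH i)) (yH k) = 1 := by
  have := q_rel (n := n) (w := gcomm (gcomm (yw j) (xw i)) (yw k))
    (Or.inl (Or.inl (Or.inr ⟨i, j, k, rfl⟩)))
  simpa only [map_gcomm, map_pow, q_xw, q_yw] using this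

theorem xyz_sq {n : ℕ} (i j : Fin n) (z : HGen n) :
    gcomm (gcomm (xH i) (yH j)) (zH z) ^ 2 = 1 := by
  have := q_rel (n := n) (w := gcomm (gcomm (xw i) (yw j)) (zw z) ^ 2)
    (Or.inl (Or.inr ⟨i, j, z, rfl⟩))
  simpa only [map_gcomm, map_pow, q_xw, q_yw, q_zw] using this

theorem zzzz {n : ℕ} (a b c d : HGen n) :
    gcomm (gcomm (gcomm (zH a) (zH b)) (zH c)) (zH d) = 1 := by
  have := q_rel (n := n) (w := gcomm (gcomm (gcomm (zw a) (zw b)) (zw c)) (zw d))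
    (Or.inr ⟨a, b, c, d, rfl⟩)
  simpa only [map_gcomm, map_pow, q_xw, q_yw, q_zw] using this

theorem closure_zH (n : ℕ) : Subgroup.closure (Set.range (zH (n := n))) = ⊤ :=
  PresentedGroup.closure_range_of _

/-- If the commutators of `g` with all generators lie in a normal subgroup, so do all. -/
theorem gcomm_mem_of_gens {n : ℕ} (Z : Subgroup (Hn n)) [Z.Normal] (g : Hn n)
    (h : ∀ z, gcomm g (zH z) ∈ Z) (w : Hn n) : gcomm g w ∈ Z := by
  have hw : w ∈ Subgroup.closure (Set.range (zH (n := n))) := by rw [closure_zH]; trivial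
  have h' : ∀ u, gcomm g u ∈ Z ↔ u ∈
      (Subgroup.centralizer {(QuotientGroup.mk' Z g)}).comap (QuotientGroup.mk' Z) := by
    intro u
    have h0 : gcomm g u ∈ Z ↔ gcomm g u ∈ (QuotientGroup.mk' Z).ker := by
      rw [QuotientGroup.ker_mk']
    rw [Subgroup.mem_comap, Subgroup.mem_centralizer_singleton_iff, h0,
      MonoidHom.mem_ker, map_gcomm, gcomm_eq_one, eq_comm]
  rw [h']
  refine (Subgroup.closure_le _).2 ?_ hw
  rintro _ ⟨z, rfl⟩
  exact (h' _).1 (h z)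

theorem ucs_of_gens {n : ℕ} (k : ℕ) (g : Hn n)
    (h : ∀ z, gcomm g (zH z) ∈ Subgroup.upperCentralSeries (Hn n) k) :
    g ∈ Subgroup.upperCentralSeries (Hn n) (k + 1) := by
  have h1 := gcomm_mem_of_gens _ g h
  rw [Subgroup.mem_upperCentralSeries_succ_iff]
  intro y
  have := Subgroup.Normal.conj_mem (H := Subgroup.upperCentralSeries (Hn n) k) inferInstance
    _ (h1 y⁻¹) g
  have e : g * y * g⁻¹ * y⁻¹ = (g * gcomm g y⁻¹ * g⁻¹)⁻¹ := by
    simp only [gcomm]; group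
  rw [commutatorElement_def, e]
  exact inv_mem this

theorem q_L3 (n : ℕ) : L3 n ≤ (q n).ker := by
  have hu : Subgroup.upperCentralSeries (Hn n) 3 = ⊤ := by
    rw [eq_top_iff, ← closure_zH, Subgroup.closure_le]
    rintro _ ⟨a, rfl⟩
    refine ucs_of_gens 2 _ fun b => ucs_of_gens 1 _ fun c => ucs_of_gens 0 _ fun d => ?_
    rw [zzzz]; exact one_mem _
  have hl : Subgroup.lowerCentralSeries (⊤ : Subgroup (Hn n)) 3 = ⊥ :=
    Subgroup.lowerCentralSeries_eq_bot_iff_upperCentralSeries_eq_top.2 hu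
  have hm := Subgroup.map_lowerCentralSeries (⊤ : Subgroup (F2 n)) (q n) 3
  have hle : (L3 n).map (q n) ≤ ⊥ := by
    rw [← hl, hm]
    exact Subgroup.lowerCentralSeries_mono 3 le_top
  exact fun w hw => hle (Subgroup.mem_map_of_mem _ hw)

theorem zz_sq {n : ℕ} (a b : HGen n) : gcomm (zH a) (zH b) ^ 2 = 1 := by
  rcases a with a | a <;> rcases b with b | b
  · change gcomm (xH a) (xH b) ^ 2 = 1
    rw [xx, one_pow]
  · exact xy_sq a b
  · change gcomm (yH a) (xH b) ^ 2 = 1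
    rw [← gcomm_inv, inv_pow, xy_sq, inv_one]
  · change gcomm (yH a) (yH b) ^ 2 = 1
    rw [yy, one_pow]

theorem gcomm_one_left {G : Type*} [Group G] (g : G) : gcomm 1 g = 1 := by simp [gcomm]

theorem yx_eq {n : ℕ} (i j : Fin n) : gcomm (yH i) (xH j) = gcomm (xH j) (yH i) := by
  rw [← gcomm_inv]
  have := xy_sq j i
  rw [pow_two] at this
  exact inv_eq_of_mul_eq_one_left this

theorem zzz_sq {n : ℕ} (a b c : HGen n) : gcomm (gcomm (zH a) (zH b)) (zH c) ^ 2 = 1 := by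
  rcases a with a | a <;> rcases b with b | b
  · change gcomm (gcomm (xH a) (xH b)) _ ^ 2 = 1
    rw [xx, gcomm_one_left, one_pow]
  · exact xyz_sq a b c
  · change gcomm (gcomm (yH a) (xH b)) _ ^ 2 = 1
    rw [yx_eq]; exact xyz_sq b a c
  · change gcomm (gcomm (yH a) (yH b)) _ ^ 2 = 1
    rw [yy, gcomm_one_left, one_pow]

theorem inv_of_sq {G : Type*} [Group G] {g : G} (h : g ^ 2 = 1) : g⁻¹ = g := by
  rw [pow_two] at h; exact inv_eq_of_mul_eq_one_left h

theorem zzz_self {n : ℕ} (a b : HGen n) : gcomm (gcomm (zH a) (zH b)) (zH a) = 1 := by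
  have h1 := inv_of_sq (zz_sq a b)
  have h2 := inv_of_sq (zH_sq a)
  have e : gcomm (gcomm (zH a) (zH b)) (zH a) =
      (gcomm (zH a) (zH b))⁻¹ * ((zH a)⁻¹ * (zH a)⁻¹ * (zH b)⁻¹ * zH a * zH b * zH a) := by
    simp only [gcomm, mul_assoc]
  have e2 : gcomm (zH a) (zH b) = (zH b)⁻¹ * (zH a)⁻¹ * zH b * zH a := by
    rw [← h1, gcomm_inv]; rfl
  have h3 : (zH a)⁻¹ * (zH a)⁻¹ = 1 := by rw [h2, ← pow_two, zH_sq]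
  rw [e, e2, h3, h2]
  group

theorem K2_le (n : ℕ) : K2 n ≤ (q n).ker := by
  refine (Subgroup.closure_le _).2 ?_
  rintro _ (hs | (((⟨a, rfl⟩ | ⟨a, b, rfl⟩) | ⟨a, b, c, rfl⟩) | ⟨a, b, rfl⟩))
  · exact q_L3 n hs
  all_goals simp only [SetLike.mem_coe, MonoidHom.mem_ker, map_pow, map_gcomm, q_zw]
  · exact zH_sq a
  · exact zz_sq a b
  · exact zzz_sq a b c
  · exact zzz_self a b

theorem I2_le (n : ℕ) : I2 n ≤ (q n).ker := by
  refine (Subgroup.closure_le _).2 ?_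
  rintro _ (hs | ((((⟨a, b, rfl⟩ | ⟨a, b, rfl⟩) | ⟨a, b, c, rfl⟩) | ⟨a, b, c, rfl⟩) |
      ⟨a, b, c, rfl⟩))
  · exact K2_le n hs
  all_goals simp only [SetLike.mem_coe, MonoidHom.mem_ker, map_gcomm, q_zw, q_xw, q_yw, xx,
    yy, yxy, gcomm_one_left]

theorem ker_q (n : ℕ) : (q n).ker = I2 n := by
  apply le_antisymm _ (I2_le n)
  have := I2_normal n
  have h : (q n).ker = Subgroup.normalClosure (HRels n) := QuotientGroup.ker_mk' _
  rw [h]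
  exact Subgroup.normalClosure_le_normal (HRels_sub n)

/-! Upper bound for the order. -/

theorem card_closure_le {G ι : Type*} [Group G] [Fintype ι] (g : ι → G)
    (hc : ∀ i j, g i * g j = g j * g i) (h2 : ∀ i, g i ^ 2 = 1) :
    Finite (Subgroup.closure (Set.range g)) ∧
      Nat.card (Subgroup.closure (Set.range g)) ≤ 2 ^ Fintype.card ι := by
  classical
  have hcomm : Pairwise fun i j : ι =>
      ∀ x y : G, x ∈ Subgroup.zpowers (g i) → y ∈ Subgroup.zpowers (g j) → Commute x y := by
    rintro i j _ _ _ ⟨a, rfl⟩ ⟨b, rfl⟩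
    exact Commute.zpow_zpow (hc i j) a b
  have hr := Subgroup.noncommPiCoprod_range (hcomm := hcomm)
  have hcl : (Subgroup.noncommPiCoprod hcomm).range = Subgroup.closure (Set.range g) := by
    rw [hr]
    simp only [Subgroup.zpowers_eq_closure]
    rw [← Subgroup.closure_iUnion, Set.iUnion_singleton_eq_range]
  have hord : ∀ i, orderOf (g i) ≤ 2 := fun i => orderOf_le_of_pow_eq_one (by norm_num) (h2 i)
  have hfin : ∀ i, Finite (Subgroup.zpowers (g i)) := by
    intro i
    refine finite_zpowers.2 ?_
    exact isOfFinOrder_iff_pow_eq_one.2 ⟨2, by norm_num, h2 i⟩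
  rw [← hcl]
  refine ⟨Finite.of_surjective _ (Subgroup.noncommPiCoprod hcomm).rangeRestrict_surjective, ?_⟩
  refine (Nat.card_le_card_of_surjective _
    (Subgroup.noncommPiCoprod hcomm).rangeRestrict_surjective).trans ?_
  rw [Nat.card_pi]
  refine (Finset.prod_le_pow_card _ _ 2 ?_).trans (by simp)
  intro i _
  rw [Nat.card_zpowers]
  exact hord i

theorem mul_eq_gcomm {G : Type*} [Group G] (g h : G) : g * h = h * g * gcomm g h := by
  unfold gcomm; group

abbrev CH {n : ℕ} (i j : Fin n) : Hn n := gcomm (xH i) (yH j)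
abbrev TH {n : ℕ} (i j k : Fin n) : Hn n := gcomm (CH i j) (xH k)

theorem CH_y {n : ℕ} (i j k : Fin n) : CH i j * yH k = yH k * CH i j := by
  rw [← gcomm_eq_one, CH, ← yx_eq]
  exact yxy i j k

theorem TH_central {n : ℕ} (i j k : Fin n) (w : Hn n) : TH i j k * w = w * TH i j k := by
  rw [← gcomm_eq_one, ← Subgroup.mem_bot]
  refine gcomm_mem_of_gens ⊥ _ ?_ w
  intro z
  rw [Subgroup.mem_bot]
  exact zzzz (Sum.inl i) (Sum.inr j) (Sum.inl k) z

theorem TH_sq {n : ℕ} (i j k : Fin n) : TH i j k ^ 2 = 1 := xyz_sq i j (Sum.inl k)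

theorem comm_aux {G : Type*} [Group G] {c x y t : G} (hcy : c * y = y * c)
    (hcx : c * x = x * c * t) (ht : ∀ w, t * w = w * t) : 
    c * gcomm x y = gcomm x y * c := by
  have e1 : c * x * c⁻¹ = x * t := by
    rw [hcx, mul_assoc x, ← ht c]; group
  have e2 : c * y * c⁻¹ = y := by rw [hcy]; group
  have e3 : c * gcomm x y * c⁻¹ = gcomm (c * x * c⁻¹) (c * y * c⁻¹) := by
    unfold gcomm; group
  rw [e1, e2] at e3
  have e4 : gcomm (x * t) y = gcomm x y := by
    have : gcomm (x * t) y = t⁻¹ * (gcomm x y * (y⁻¹ * (t * y))) := by unfold gcomm; group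
    rw [this, ht y]
    have : t⁻¹ * (gcomm x y * (y⁻¹ * (y * t))) = t⁻¹ * (gcomm x y * t) := by group
    rw [this, ← ht]; group
  rw [e4] at e3
  exact mul_inv_eq_iff_eq_mul.1 e3

theorem CH_CH {n : ℕ} (i j k l : Fin n) : CH i j * CH k l = CH k l * CH i j :=
  comm_aux (CH_y i j l) (mul_eq_gcomm _ _) (TH_central i j k)

theorem symm_aux {G : Type*} [Group G] {x x' y c c' t t' : G} (h1 : y * x = x * y * c)
    (h2 : y * x' = x' * y * c') (h3 : c * x' = x' * c * t) (h4 : c' * x = x * c' * t')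
    (hx : x * x' = x' * x) (hc : c * c' = c' * c) : t = t' := by
  have e1 : y * (x * x') = x * x' * y * (c' * c) * t := by
    calc y * (x * x') = (y * x) * x' := by group
      _ = x * y * (c * x') := by rw [h1]; group
      _ = x * (y * x') * c * t := by rw [h3]; group
      _ = _ := by rw [h2]; group
  have e2 : y * (x' * x) = x' * x * y * (c * c') * t' := by
    calc y * (x' * x) = (y * x') * x := by group
      _ = x' * y * (c' * x) := by rw [h2]; group
      _ = x' * (y * x) * c' * t' := by rw [h4]; group
      _ = _ := by rw [h1]; group
  rw [hx, e2, hc] at e1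
  exact (mul_left_cancel e1).symm

theorem xx_comm {n : ℕ} (i j : Fin n) : xH i * xH j = xH j * xH i := gcomm_eq_one.1 (xx i j)
theorem yy_comm {n : ℕ} (i j : Fin n) : yH i * yH j = yH j * yH i := gcomm_eq_one.1 (yy i j)

theorem yx_mul {n : ℕ} (i j : Fin n) : yH j * xH i = xH i * yH j * CH i j := by
  rw [mul_eq_gcomm, yx_eq]

theorem TH_symm {n : ℕ} (i j k : Fin n) : TH i j k = TH k j i :=
  symm_aux (yx_mul i j) (yx_mul k j) (mul_eq_gcomm _ _) (mul_eq_gcomm _ _) (xx_comm i k)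
    (CH_CH i j k j)

theorem TH_self {n : ℕ} (i j : Fin n) : TH i j i = 1 := zzz_self (Sum.inl i) (Sum.inr j)

abbrev P (n : ℕ) := {p : Fin n × Fin n // p.1 < p.2}

abbrev J (n : ℕ) := Fin n ⊕ (Fin n × Fin n) ⊕ (Fin n × P n)

def gen {n : ℕ} : J n → Hn n
  | .inl j => yH j
  | .inr (.inl p) => CH p.1 p.2
  | .inr (.inr p) => TH p.2.1.1 p.1 p.2.1.2

theorem gen_comm {n : ℕ} (a b : J n) : gen a * gen b = gen b * gen a := by
  rcases a with a | a | a <;> rcases b with b | b | b <;> simp only [gen]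
  · exact yy_comm _ _
  · exact (CH_y _ _ _).symm
  · exact (TH_central _ _ _ _).symm
  · exact CH_y _ _ _
  · exact CH_CH _ _ _ _
  · exact (TH_central _ _ _ _).symm
  · exact TH_central _ _ _ _
  · exact TH_central _ _ _ _
  · exact TH_central _ _ _ _

theorem gen_sq {n : ℕ} (a : J n) : gen a ^ 2 = 1 := by
  rcases a with a | a | a
  · exact zH_sq (Sum.inr a)
  · exact xy_sq _ _
  · exact TH_sq _ _ _

abbrev NH (n : ℕ) : Subgroup (Hn n) := Subgroup.closure (Set.range (gen (n := n)))

theorem gen_mem {n : ℕ} (a : J n) : gen a ∈ NH n := Subgroup.subset_closure ⟨a, rfl⟩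

theorem TH_mem {n : ℕ} (i j k : Fin n) : TH i j k ∈ NH n := by
  rcases lt_trichotomy i k with h | h | h
  · exact gen_mem (.inr (.inr (j, ⟨(i, k), h⟩)))
  · subst h; rw [TH_self]; exact one_mem _
  · rw [TH_symm]; exact gen_mem (.inr (.inr (j, ⟨(k, i), h⟩)))

theorem NH_normal (n : ℕ) : (NH n).Normal := by
  refine normal_of_gens (Set.range (zH (n := n))) _ (closure_zH n) ?_ ?_
  · rintro _ ⟨z, rfl⟩ _ ⟨a, rfl⟩
    rcases z with k | k
    · change gcomm (gen a) (xH k) ∈ NH n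
      rcases a with a | a | a <;> simp only [gen]
      · rw [yx_eq]; exact gen_mem (.inr (.inl (k, a)))
      · exact TH_mem _ _ _
      · rw [gcomm_eq_one.2 (TH_central _ _ _ _)]; exact one_mem _
    · change gcomm (gen a) (gen (.inl k)) ∈ NH n
      rw [gcomm_eq_one.2 (gen_comm _ _)]; exact one_mem _
  · rintro _ ⟨z, rfl⟩
    rw [zH_sq]; exact one_mem _

theorem sup_top (n : ℕ) : XH n ⊔ NH n = ⊤ := by
  rw [eq_top_iff, ← closure_zH, Subgroup.closure_le]
  rintro _ ⟨z | z, rfl⟩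
  · exact Subgroup.mem_sup_left (Subgroup.subset_closure ⟨z, rfl⟩)
  · exact Subgroup.mem_sup_right (gen_mem (.inl z))

theorem upper (n : ℕ) : Finite (Hn n) ∧
    Nat.card (Hn n) ≤ 2 ^ n * 2 ^ Fintype.card (J n) := by
  obtain ⟨f1, c1⟩ := card_closure_le (xH (n := n)) xx_comm (fun i => zH_sq (Sum.inl i))
  obtain ⟨f2, c2⟩ := card_closure_le (gen (n := n)) gen_comm gen_sq
  have := NH_normal n
  have hs : Function.Surjective (fun p : XH n × NH n => (p.1 : Hn n) * p.2) := by
    intro w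
    have hw : w ∈ ((XH n ⊔ NH n : Subgroup (Hn n)) : Set (Hn n)) := by rw [sup_top]; trivial
    rw [Subgroup.mul_normal] at hw
    obtain ⟨a, ha, b, hb, rfl⟩ := hw
    exact ⟨(⟨a, ha⟩, ⟨b, hb⟩), rfl⟩
  have f1' : Finite (XH n) := f1
  refine ⟨Finite.of_surjective _ hs, ?_⟩
  refine (Nat.card_le_card_of_surjective _ hs).trans ?_
  rw [Nat.card_prod]
  rw [Fintype.card_fin] at c1
  exact Nat.mul_le_mul c1 c2

theorem card_J (n : ℕ) : n + Fintype.card (J n) = (n ^ 3 + n ^ 2 + 4 * n) / 2 := by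
  have hP : 2 * Fintype.card (P n) + n = n * n := by
    have h1 : Fintype.card (P n) = ∑ k ∈ Finset.range n, k := by
      rw [Fintype.card_subtype, Finset.card_filter, Fintype.sum_prod_type_right,
        Finset.sum_range]
      refine Finset.sum_congr rfl fun k _ => ?_
      rw [← Finset.card_filter]
      have e : (Finset.univ.filter fun x : Fin n => x < k) = Finset.Iio k := by ext; simp
      exact e ▸ Fin.card_Iio k
    have h2 := Finset.sum_range_id_mul_two n
    rw [h1]
    rcases n with _ | n
    · simp
    · simp only [Nat.add_sub_cancel] at h2
      nlinarith
  simp only [J, Fintype.card_sum, Fintype.card_prod, Fintype.card_fin]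
  symm
  apply Nat.div_eq_of_eq_mul_right (by norm_num)
  have : n * (2 * Fintype.card (P n) + n) = n * (n * n) := by rw [hP]
  nlinarith


/-! The model group. -/

@[ext] structure M (n : ℕ) where
  x : Fin n → ZMod 2
  a : Fin n → ZMod 2
  b : Fin n × Fin n → ZMod 2
  c : Fin n × P n → ZMod 2

namespace M
variable {n : ℕ}

instance : Mul (M n) := ⟨fun g h =>
  { x := g.x + h.x
    a := g.a + h.a
    b := fun p => g.b p + g.a p.2 * h.x p.1 + h.b p
    c := fun p => g.c p + g.b (p.2.1.1, p.1) * h.x p.2.1.2 + g.b (p.2.1.2, p.1) * h.x p.2.1.1 +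
      g.a p.1 * h.x p.2.1.1 * h.x p.2.1.2 + h.c p }⟩

instance : One (M n) := ⟨⟨0, 0, 0, 0⟩⟩

instance : Inv (M n) := ⟨fun g =>
  { x := -g.x
    a := -g.a
    b := fun p => -(g.b p - g.a p.2 * g.x p.1)
    c := fun p => -(g.c p - g.b (p.2.1.1, p.1) * g.x p.2.1.2 - g.b (p.2.1.2, p.1) * g.x p.2.1.1 +
      g.a p.1 * g.x p.2.1.1 * g.x p.2.1.2) }⟩

@[simp] theorem one_x : (1 : M n).x = 0 := rfl
@[simp] theorem one_a : (1 : M n).a = 0 := rfl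
@[simp] theorem one_b : (1 : M n).b = 0 := rfl
@[simp] theorem one_c : (1 : M n).c = 0 := rfl
@[simp] theorem mul_x (g h : M n) : (g * h).x = g.x + h.x := rfl
@[simp] theorem mul_a (g h : M n) : (g * h).a = g.a + h.a := rfl
@[simp] theorem mul_b (g h : M n) (p) : (g * h).b p = g.b p + g.a p.2 * h.x p.1 + h.b p := rfl
@[simp] theorem mul_c (g h : M n) (p) : (g * h).c p = g.c p + g.b (p.2.1.1, p.1) * h.x p.2.1.2 +
    g.b (p.2.1.2, p.1) * h.x p.2.1.1 + g.a p.1 * h.x p.2.1.1 * h.x p.2.1.2 + h.c p := rfl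
@[simp] theorem inv_x (g : M n) : (g⁻¹).x = -g.x := rfl
@[simp] theorem inv_a (g : M n) : (g⁻¹).a = -g.a := rfl
@[simp] theorem inv_b (g : M n) (p) : (g⁻¹).b p = -(g.b p - g.a p.2 * g.x p.1) := rfl
@[simp] theorem inv_c (g : M n) (p) : (g⁻¹).c p = -(g.c p - g.b (p.2.1.1, p.1) * g.x p.2.1.2 -
    g.b (p.2.1.2, p.1) * g.x p.2.1.1 + g.a p.1 * g.x p.2.1.1 * g.x p.2.1.2) := rfl

instance : Group (M n) := Group.ofLeftAxioms
  (by
    intro g h k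
    ext p
    · simp [add_assoc]
    · simp [add_assoc]
    · simp; ring
    · simp; ring)
  (by intro g; ext p <;> simp)
  (by
    intro g
    ext p
    · simp [-ZMod.neg_eq_self_mod_two]
    · simp [-ZMod.neg_eq_self_mod_two]
    · simp [-ZMod.neg_eq_self_mod_two]; ring
    · simp [-ZMod.neg_eq_self_mod_two]; ring)

def X (i : Fin n) : M n := ⟨Pi.single i 1, 0, 0, 0⟩
def Y (j : Fin n) : M n := ⟨0, Pi.single j 1, 0, 0⟩

theorem comm_of_x {g h : M n} (hg : g.x = 0) (hh : h.x = 0) : gcomm g h = 1 := by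
  rw [gcomm_eq_one]
  ext p <;> simp [hg, hh, add_comm]

theorem sq_of_x {g : M n} (hg : g.x = 0) : g ^ 2 = 1 := by
  rw [pow_two]
  ext p <;> simp [hg, CharTwo.add_self_eq_zero]

theorem gcomm_x (g h : M n) : (gcomm g h).x = 0 := by
  simp [gcomm]

theorem gcomm_a (g h : M n) : (gcomm g h).a = 0 := by
  simp [gcomm]

theorem gcomm_b (g h : M n) (h1 : g.x = 0) (h2 : g.a = 0) : (gcomm g h).b = 0 := by
  ext p
  simp [gcomm, h1, h2, -ZMod.neg_eq_self_mod_two]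
  ring

theorem gcomm_four (g h : M n) (h1 : g.x = 0) (h2 : g.a = 0) (h3 : g.b = 0) : gcomm g h = 1 := by
  rw [gcomm_eq_one]
  ext p <;> simp [h1, h2, h3, add_comm]

def Z : HGen n → M n
  | .inl i => X i
  | .inr j => Y j

theorem lift_rel (w : F2 n) (h : w ∈ HRels n) : FreeGroup.lift (Z (n := n)) w = 1 := by
  have hx : ∀ i, FreeGroup.lift (Z (n := n)) (xw i) = X i := fun i => by simp [xw, Z]
  have hy : ∀ i, FreeGroup.lift (Z (n := n)) (yw i) = Y i := fun i => by simp [yw, Z]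
  have hz : ∀ i, FreeGroup.lift (Z (n := n)) (zw i) = Z i := fun i => by simp [zw]
  rcases h with ((((((⟨z, rfl⟩ | ⟨i, j, rfl⟩) | ⟨i, j, rfl⟩) | ⟨i, j, rfl⟩) | ⟨i, j, k, rfl⟩) |
    ⟨i, j, z, rfl⟩) | ⟨a, b, c, d, rfl⟩) <;> simp only [map_pow, map_gcomm, hx, hy, hz]
  · rcases z with i | j
    · rw [pow_two]
      ext p <;> simp [Z, X, CharTwo.add_self_eq_zero]
    · exact sq_of_x rfl
  · rw [gcomm_eq_one]
    ext p <;> simp [X, add_comm]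
  · exact comm_of_x rfl rfl
  · exact sq_of_x (gcomm_x _ _)
  · exact comm_of_x (gcomm_x _ _) rfl
  · exact sq_of_x (gcomm_x _ _)
  · exact gcomm_four _ _ (gcomm_x _ _) (gcomm_a _ _) (gcomm_b _ _ (gcomm_x _ _) (gcomm_a _ _))

def f : Hn n →* M n := PresentedGroup.toGroup (f := Z) lift_rel

theorem X_mem (i : Fin n) : X i ∈ (f (n := n)).range :=
  ⟨xH i, PresentedGroup.toGroup.of lift_rel⟩
theorem Y_mem (i : Fin n) : Y i ∈ (f (n := n)).range :=
  ⟨yH i, PresentedGroup.toGroup.of lift_rel⟩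

theorem gcomm_mem' {G : Type*} [Group G] {A : Subgroup G} {g h : G} (hg : g ∈ A) (hh : h ∈ A) :
    gcomm g h ∈ A := mul_mem (mul_mem (mul_mem (inv_mem hg) (inv_mem hh)) hg) hh

theorem B_eq (i j : Fin n) : ∃ g ∈ (f (n := n)).range, g.x = 0 ∧ g.a = 0 ∧
    g.b = Pi.single (i, j) 1 := by
  refine ⟨gcomm (Y j) (X i), gcomm_mem' (Y_mem j) (X_mem i), gcomm_x _ _, gcomm_a _ _, ?_⟩
  ext ⟨p, q⟩
  simp [gcomm, X, Y, Pi.single_apply]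
  grind

theorem C_eq (i : Fin n) (p : P n) :
    (⟨0, 0, 0, Pi.single (i, p) 1⟩ : M n) ∈ (f (n := n)).range := by
  obtain ⟨g, hg, h1, h2, h3⟩ := B_eq p.1.1 i
  have : (⟨0, 0, 0, Pi.single (i, p) 1⟩ : M n) = gcomm g (X p.1.2) := by
    have hp := p.2
    ext r
    · rw [gcomm_x]
    · rw [gcomm_a]
    · rw [gcomm_b _ _ h1 h2]
    · obtain ⟨r, ⟨⟨s, t⟩, hst⟩⟩ := r
      obtain ⟨⟨u, v⟩, huv⟩ := p
      simp [gcomm, X, h1, h2, h3, Pi.single_apply]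
      grind
  rw [this]
  exact gcomm_mem' hg (X_mem _)

/-- A hom from functions into `M n` lands in a subgroup when the images of singles do. -/
theorem pi_mem {ι : Type*} [Finite ι] [DecidableEq ι] (φ : (ι → ZMod 2) → M n) (R : Subgroup (M n))
    (h0 : φ 0 = 1)
    (hφ : ∀ u v, φ (u + v) = φ u * φ v) (h : ∀ i, φ (Pi.single i 1) ∈ R) (u : ι → ZMod 2) :
    φ u ∈ R := by
  have := Fintype.ofFinite ι
  induction u using Pi.single_induction with
  | zero => rw [h0]; exact one_mem _
  | add u v hu hv => rw [hφ]; exact mul_mem hu hv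
  | single i m =>
    have hm : m = 0 ∨ m = 1 := by revert m; decide
    rcases hm with rfl | rfl
    · rw [Pi.single_zero, h0]; exact one_mem _
    · exact h i

theorem f_surj : Function.Surjective (f (n := n)) := by
  have hc : ∀ c, (⟨0, 0, 0, c⟩ : M n) ∈ (f (n := n)).range := by
    refine pi_mem _ _ rfl ?_ ?_
    · intro u v; ext p <;> simp
    · rintro ⟨i, p⟩; exact C_eq i p
  have hb : ∀ b, (⟨0, 0, b, 0⟩ : M n) ∈ (f (n := n)).range := by
    refine pi_mem _ _ rfl ?_ ?_
    · intro u v; ext p <;> simp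
    · rintro ⟨i, j⟩
      obtain ⟨g, hg, h1, h2, h3⟩ := B_eq i j
      have : (⟨0, 0, Pi.single (i, j) 1, 0⟩ : M n) = g * ⟨0, 0, 0, -g.c⟩ := by
        ext p <;> simp [h1, h2, h3, -ZMod.neg_eq_self_mod_two]
      rw [this]
      exact mul_mem hg (hc _)
  have ha : ∀ a, (⟨0, a, 0, 0⟩ : M n) ∈ (f (n := n)).range := by
    refine pi_mem _ _ rfl ?_ Y_mem
    intro u v; ext p <;> simp
  have hx : ∀ x, (⟨x, 0, 0, 0⟩ : M n) ∈ (f (n := n)).range := by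
    refine pi_mem _ _ rfl ?_ X_mem
    intro u v; ext p <;> simp
  rw [← MonoidHom.range_eq_top, eq_top_iff]
  intro m _
  have : m = ⟨m.x, 0, 0, 0⟩ * ⟨0, m.a, 0, 0⟩ * ⟨0, 0, m.b, 0⟩ * ⟨0, 0, 0, m.c⟩ := by
    ext p <;> simp
  rw [this]
  exact mul_mem (mul_mem (mul_mem (hx _) (ha _)) (hb _)) (hc _)

def equivProd : M n ≃ (Fin n → ZMod 2) × (J n → ZMod 2) where
  toFun m := (m.x, Sum.elim m.a (Sum.elim m.b m.c))
  invFun p := ⟨p.1, fun j => p.2 (.inl j), fun j => p.2 (.inr (.inl j)),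
    fun j => p.2 (.inr (.inr j))⟩
  left_inv m := rfl
  right_inv p := by
    ext j
    · rfl
    · rcases j with j | j | j <;> rfl

theorem card_M : Nat.card (M n) = 2 ^ n * 2 ^ Fintype.card (J n) := by
  rw [Nat.card_congr equivProd, Nat.card_prod, Nat.card_fun, Nat.card_fun]
  simp

end M

theorem card_Hn (n : ℕ) : Nat.card (Hn n) = 2 ^ ((n ^ 3 + n ^ 2 + 4 * n) / 2) := by
  rw [← card_J, pow_add]
  obtain ⟨hf, hu⟩ := upper n
  refine le_antisymm hu ?_
  rw [← M.card_M]
  exact Nat.card_le_card_of_surjective _ M.f_surj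

end St12

/-- The assignment `x_i ↦ a_i I`, `y_i ↦ a_{n+i} I` defines a group isomorphism
`H(n) ≅ F/I`; equivalently, there is a surjective homomorphism `ψ : F →* H(n)` with
`ψ(a_i) = x_i`, `ψ(a_{n+i}) = y_i` and `ker ψ = I` (the induced isomorphism
`F/I ≅ H(n)` is inverse to the one of the statement).  In particular
`|H(n)| = 2^{(n³+n²+4n)/2}`. -/
theorem statement12 (n : ℕ) (hn : 2 ≤ n) :
    (∃ ψ : F2 n →* Hn n,
      (∀ i : Fin n, ψ (xw i) = xH i) ∧
      (∀ i : Fin n, ψ (yw i) = yH i) ∧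
      Function.Surjective ψ ∧ ψ.ker = I2 n) ∧
    Nat.card (Hn n) = 2 ^ ((n ^ 3 + n ^ 2 + 4 * n) / 2) := by
  refine ⟨⟨St12.q n, fun _ => rfl, fun _ => rfl, ?_, St12.ker_q n⟩, St12.card_Hn n⟩
  exact QuotientGroup.mk'_surjective _
end
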